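/- Fix 0 < R₁ < R₂ and let N ≥ 4 be an even integer. For every ε ∈ (0, π/N), the lowest Dirichlet eigenvalue of 𝔇(N,ε) in the symmetry class A_{N/2} is strictly larger than the lowest Dirichlet eigenvalue in the symmetry class A_1: λ₁^{(N/2)}(𝔇(N,ε)) > λ₁^{(1)}(𝔇(N,ε)). -/

import Mathlib

open MeasureTheory Real Set

noncomputable section

/-- A Dirichlet test function on `ω`: smooth, compactly supported, with support in `ω`. -/
def testFun (ω : Set (ℝ × ℝ)) (u : (ℝ × ℝ) → ℝ) : Prop :=
  ContDiff ℝ (⊤ : ℕ∞) u ∧ HasCompactSupport u ∧ tsupport u ⊆ ω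

/-- `|∇u|²` at a point. -/
def gradSq (u : (ℝ × ℝ) → ℝ) (x : ℝ × ℝ) : ℝ :=
  fderiv ℝ u x (1, 0) ^ 2 + fderiv ℝ u x (0, 1) ^ 2

/-- The Rayleigh quotient of `u` on `ω`. -/
def rayleigh (ω : Set (ℝ × ℝ)) (u : (ℝ × ℝ) → ℝ) : ℝ :=
  (∫ x in ω, gradSq u x) / ∫ x in ω, u x ^ 2

/-- The `k`-th Dirichlet eigenvalue of `ω` (`k ≥ 1`), via the Courant–Fischer
min-max formula over `k`-dimensional subspaces of `C_c^∞(ω)`. -/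
def dirichletEV (ω : Set (ℝ × ℝ)) (k : ℕ) : ℝ :=
  sInf {l | ∃ V : Submodule ℝ ((ℝ × ℝ) → ℝ),
    (V : Set ((ℝ × ℝ) → ℝ)) ⊆ {u | testFun ω u} ∧ Module.finrank ℝ V = k ∧
    l = sSup {r | ∃ u ∈ V, u ≠ 0 ∧ r = rayleigh ω u}}

/-- The open disk `B_R` centered at the origin. -/
def disk (R : ℝ) : Set (ℝ × ℝ) := {x | x.1 ^ 2 + x.2 ^ 2 < R ^ 2}

/-- The open annulus `M_{R₁,R₂} = B_{R₂} \ closure (B_{R₁})`. -/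
def annulus (R₁ R₂ : ℝ) : Set (ℝ × ℝ) := disk R₂ \ closure (disk R₁)

/-- `D_{R₁,R₂} = B_{R₁} ∪ M_{R₁,R₂}`. -/
def diskUnionAnnulus (R₁ R₂ : ℝ) : Set (ℝ × ℝ) := disk R₁ ∪ annulus R₁ R₂

/-- The cracked domain `𝔇(N,ε)`. -/
def crackedDomain (R₁ R₂ : ℝ) (N : ℕ) (ε : ℝ) : Set (ℝ × ℝ) :=
  diskUnionAnnulus R₁ R₂ ∪
    ⋃ j ∈ Finset.range N, {x | ∃ θ : ℝ, θ ∈ Set.Ioo (2 * π * j / N - ε) (2 * π * j / N + ε) ∧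
      x = (R₁ * Real.cos θ, R₁ * Real.sin θ)}

/-- Rotation of the plane by angle `α` about the origin. -/
def rot (α : ℝ) (x : ℝ × ℝ) : ℝ × ℝ :=
  (Real.cos α * x.1 - Real.sin α * x.2, Real.sin α * x.1 + Real.cos α * x.2)

/-- The symmetry class `A_ℓ` for the rotation `g` by `2π/N`:
`u − 2cos(2πℓ/N)(g·u) + (g²·u) = 0`, where `(g·u)(x) = u(g⁻¹x)`. -/
def inAClass (N ℓ : ℕ) (u : (ℝ × ℝ) → ℝ) : Prop :=
  ∀ x, u x - 2 * Real.cos (2 * π * ℓ / N) * u (rot (-(2 * π / N)) x)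
      + u (rot (-(2 * (2 * π / N))) x) = 0

/-- The `k`-th Dirichlet eigenvalue of `Ω` in the symmetry class `A_ℓ`, via the min-max
formula with test subspaces contained in `C_c^∞(Ω) ∩ A_ℓ`. -/
def symDirichletEV (ω : Set (ℝ × ℝ)) (N ℓ k : ℕ) : ℝ :=
  sInf {l | ∃ V : Submodule ℝ ((ℝ × ℝ) → ℝ),
    (V : Set ((ℝ × ℝ) → ℝ)) ⊆ {u | testFun ω u ∧ inAClass N ℓ u} ∧ Module.finrank ℝ V = k ∧
    l = sSup {r | ∃ u ∈ V, u ≠ 0 ∧ r = rayleigh ω u}}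

/-- The lowest Dirichlet eigenvalue of `ω` in the symmetry class `A_ℓ`:
the infimum of the Rayleigh quotient over nonzero `u ∈ C_c^∞(ω) ∩ A_ℓ`. -/
def symLambda1 (ω : Set (ℝ × ℝ)) (N ℓ : ℕ) : ℝ :=
  sInf {r | ∃ u, testFun ω u ∧ inAClass N ℓ u ∧ u ≠ 0 ∧ r = rayleigh ω u}

/-- The point with polar coordinates `(r, θ)`. -/
def polarPt (r θ : ℝ) : ℝ × ℝ := (r * Real.cos θ, r * Real.sin θ)

/-- The squared Euclidean norm on the plane. -/
def nsq (x : ℝ × ℝ) : ℝ := x.1 ^ 2 + x.2 ^ 2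

/-- The principal argument of a point of the plane. -/
def ang (x : ℝ × ℝ) : ℝ := Complex.arg ⟨x.1, x.2⟩

/-- The reflection in the first coordinate axis. -/
def refl₁ (x : ℝ × ℝ) : ℝ × ℝ := (x.1, -x.2)

lemma nsq_nonneg (x : ℝ × ℝ) : 0 ≤ nsq x := by unfold nsq; positivity

lemma nsq_polarPt (r θ : ℝ) : nsq (polarPt r θ) = r ^ 2 := by
  simp only [nsq, polarPt]; nlinarith [Real.sin_sq_add_cos_sq θ]

lemma polarPt_ang (x : ℝ × ℝ) : polarPt (√(nsq x)) (ang x) = x := by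
  have h := Complex.norm_mul_cos_arg ⟨x.1, x.2⟩
  have h' := Complex.norm_mul_sin_arg ⟨x.1, x.2⟩
  have hn : ‖(⟨x.1, x.2⟩ : ℂ)‖ = √(nsq x) := by
    rw [Complex.norm_def, Complex.normSq_mk]; congr 1; simp only [nsq]; ring
  rw [hn] at h h'
  exact Prod.ext h h'

lemma continuousAt_ang {x : ℝ × ℝ} (hx : 0 < x.1) : ContinuousAt ang x := by
  have h1 : ContinuousAt (fun y : ℝ × ℝ => (⟨y.1, y.2⟩ : ℂ)) x := by
    have : (fun y : ℝ × ℝ => (⟨y.1, y.2⟩ : ℂ)) = Complex.equivRealProdCLM.symm := by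
      ext y : 1
      apply Complex.ext <;> simp [Complex.equivRealProdCLM_symm_apply]
    rw [this]; exact Complex.equivRealProdCLM.symm.continuous.continuousAt
  exact ContinuousAt.comp (f := fun y : ℝ × ℝ => (⟨y.1, y.2⟩ : ℂ)) (g := Complex.arg)
    (Complex.continuousAt_arg (Or.inl hx)) h1

lemma rot_polarPt (α r θ : ℝ) : rot α (polarPt r θ) = polarPt r (θ + α) := by
  simp only [rot, polarPt, Real.cos_add, Real.sin_add]
  ext <;> simp <;> ring

lemma rot_rot (α β : ℝ) (x : ℝ × ℝ) : rot α (rot β x) = rot (α + β) x := by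
  simp only [rot, Real.cos_add, Real.sin_add]
  ext <;> simp <;> ring

lemma rot_zero' (x : ℝ × ℝ) : rot 0 x = x := by simp [rot]

lemma rot_zero_pt (α : ℝ) : rot α 0 = 0 := by simp [rot]

lemma nsq_rot (α : ℝ) (x : ℝ × ℝ) : nsq (rot α x) = nsq x := by
  simp only [nsq, rot]
  linear_combination (x.1 ^ 2 + x.2 ^ 2) * Real.sin_sq_add_cos_sq α

lemma nsq_rot_sub (α : ℝ) (x p : ℝ × ℝ) : nsq (rot α x - rot α p) = nsq (x - p) := by
  simp only [nsq, rot, Prod.fst_sub, Prod.snd_sub]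
  linear_combination ((x.1 - p.1) ^ 2 + (x.2 - p.2) ^ 2) * Real.sin_sq_add_cos_sq α

lemma continuous_rot (α : ℝ) : Continuous (rot α) := by unfold rot; fun_prop

lemma continuous_nsq : Continuous nsq := by unfold nsq; fun_prop

lemma continuous_polarPt : Continuous (fun q : ℝ × ℝ => polarPt q.1 q.2) := by
  unfold polarPt; fun_prop

lemma polarPt_add_two_pi_mul (r θ : ℝ) (k : ℤ) : polarPt r (θ + 2 * π * k) = polarPt r θ := by
  have h : θ + 2 * π * k = θ + k * (2 * π) := by ring
  simp only [polarPt, h, Real.cos_add_int_mul_two_pi, Real.sin_add_int_mul_two_pi]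

lemma angle_eq_of_polarPt_eq {r θ θ' : ℝ} (hr : r ≠ 0) (h : polarPt r θ = polarPt r θ') :
    ∃ k : ℤ, θ = θ' + 2 * π * k := by
  have h1 := congrArg Prod.fst h
  have h2 := congrArg Prod.snd h
  simp only [polarPt] at h1 h2
  have := Real.Angle.cos_sin_inj (mul_left_cancel₀ hr h1) (mul_left_cancel₀ hr h2)
  obtain ⟨k, hk⟩ := Real.Angle.angle_eq_iff_two_pi_dvd_sub.1 this
  exact ⟨k, by linarith⟩

lemma exists_continuousAt_angle {r : ℝ} (hr : 0 < r) (θ₀ : ℝ) :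
    ∃ Θ : ℝ × ℝ → ℝ, ContinuousAt Θ (polarPt r θ₀) ∧ Θ (polarPt r θ₀) = θ₀ ∧
      ∀ x, polarPt (√(nsq x)) (Θ x) = x := by
  have h0 : rot (-θ₀) (polarPt r θ₀) = (r, 0) := by
    rw [rot_polarPt]; simp [polarPt]
  refine ⟨fun x => ang (rot (-θ₀) x) + θ₀, ?_, ?_, fun x => ?_⟩
  · refine ContinuousAt.add ?_ continuousAt_const
    refine ContinuousAt.comp (f := rot (-θ₀)) (g := ang) ?_ (continuous_rot _).continuousAt
    apply continuousAt_ang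
    rw [h0]; exact hr
  · simp only [h0]
    have : ang (r, 0) = 0 := Complex.arg_ofReal_of_nonneg hr.le
    rw [this, zero_add]
  · have := polarPt_ang (rot (-θ₀) x)
    rw [nsq_rot] at this
    rw [← rot_polarPt, this, rot_rot]; simp [rot_zero']

lemma closure_disk {R : ℝ} (hR : 0 < R) : closure (disk R) = {x | nsq x ≤ R ^ 2} := by
  apply subset_antisymm
  · refine closure_minimal (fun x hx => ?_) (isClosed_le continuous_nsq continuous_const)
    exact le_of_lt (show nsq x < R ^ 2 from hx)
  · intro x hx
    have hx' : nsq x ≤ R ^ 2 := hx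
    have ht : Filter.Tendsto (fun t : ℝ => t • x) (nhdsWithin 1 (Set.Ioo 0 1)) (nhds x) := by
      have : ContinuousAt (fun t : ℝ => t • x) 1 := by fun_prop
      have h2 := this.tendsto.mono_left (nhdsWithin_le_nhds (s := Set.Ioo 0 1))
      simpa using h2
    have : (nhdsWithin (1 : ℝ) (Set.Ioo 0 1)).NeBot := right_nhdsWithin_Ioo_neBot one_pos
    refine mem_closure_of_tendsto ht ?_
    filter_upwards [self_mem_nhdsWithin] with t ht
    have hts : nsq (t • x) = t ^ 2 * nsq x := by simp [nsq]; ring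
    change nsq (t • x) < R ^ 2
    rw [hts]
    have h1 : t ^ 2 < 1 := by nlinarith [ht.1, ht.2]
    have h2 : t ^ 2 * nsq x ≤ t ^ 2 * R ^ 2 := by gcongr
    nlinarith [pow_pos hR 2]

lemma mem_crackedDomain {R₁ R₂ : ℝ} (hR₁ : 0 < R₁) (hR₁₂ : R₁ < R₂) {N : ℕ} (hN : 0 < N) {ε : ℝ}
    {x : ℝ × ℝ} : x ∈ crackedDomain R₁ R₂ N ε ↔ nsq x < R₂ ^ 2 ∧ (nsq x ≠ R₁ ^ 2 ∨
      ∃ j : ℤ, ∃ θ ∈ Set.Ioo (2 * π * j / N - ε) (2 * π * j / N + ε), x = polarPt R₁ θ) := by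
  have hlt : R₁ ^ 2 < R₂ ^ 2 := by nlinarith
  have hN' : (N : ℝ) ≠ 0 := by positivity
  simp only [crackedDomain, diskUnionAnnulus, annulus, closure_disk hR₁, Set.mem_union,
    Set.mem_sdiff, Set.mem_iUnion, Set.mem_ofPred_eq, Finset.mem_range]
  have e1 : ∀ R, x ∈ disk R ↔ nsq x < R ^ 2 := fun R => Iff.rfl
  rw [e1, e1]
  constructor
  · rintro ((h | h) | ⟨j, hj, θ, hθ, rfl⟩)
    · exact ⟨h.trans hlt, Or.inl h.ne⟩
    · exact ⟨h.1, Or.inl (not_le.1 h.2).ne'⟩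
    · refine ⟨?_, Or.inr ⟨j, θ, by exact_mod_cast hθ, rfl⟩⟩
      rw [show (R₁ * Real.cos θ, R₁ * Real.sin θ) = polarPt R₁ θ from rfl, nsq_polarPt]
      exact hlt
  · rintro ⟨h, h' | ⟨j, θ, hθ, rfl⟩⟩
    · rcases lt_or_gt_of_ne h' with h'' | h''
      · exact Or.inl (Or.inl h'')
      · exact Or.inl (Or.inr ⟨h, not_le.2 h''⟩)
    · right
      have hNz : (N : ℤ) ≠ 0 := by exact_mod_cast hN.ne'
      have hm := Int.emod_nonneg j hNz
      have hm2 := Int.emod_lt_of_pos j (show (0 : ℤ) < N by exact_mod_cast hN)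
      have hdj : (j : ℝ) = (N : ℝ) * ((j / N : ℤ) : ℝ) + ((j % N : ℤ) : ℝ) := by
        exact_mod_cast (Int.mul_ediv_add_emod j N).symm
      refine ⟨(j % N).toNat, by omega, θ + 2 * π * ((-(j / N) : ℤ) : ℝ), ?_,
        (polarPt_add_two_pi_mul _ _ _).symm⟩
      have hcast : (((j % N).toNat : ℕ) : ℝ) = ((j % N : ℤ) : ℝ) := by
        exact_mod_cast (congrArg (Int.cast (R := ℝ)) (Int.toNat_of_nonneg hm))
      have : 2 * π * (j : ℝ) / N = 2 * π * ((j / N : ℤ) : ℝ) + 2 * π * ((j % N : ℤ) : ℝ) / N := by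
        rw [hdj]; field_simp
      rw [this] at hθ
      rw [hcast]
      push_cast
      constructor <;> linarith [hθ.1, hθ.2]

lemma isOpen_crackedDomain {R₁ R₂ : ℝ} (hR₁ : 0 < R₁) (hR₁₂ : R₁ < R₂) {N : ℕ} (hN : 0 < N)
    {ε : ℝ} : IsOpen (crackedDomain R₁ R₂ N ε) := by
  rw [isOpen_iff_mem_nhds]
  intro x hx
  obtain ⟨h1, h2⟩ := (mem_crackedDomain hR₁ hR₁₂ hN).1 hx
  have e1 : ∀ᶠ y in nhds x, nsq y < R₂ ^ 2 :=
    continuous_nsq.continuousAt.eventually (Iio_mem_nhds h1)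
  rcases h2 with h2 | ⟨j, θ, hθ, rfl⟩
  · have e2 : ∀ᶠ y in nhds x, nsq y ≠ R₁ ^ 2 :=
      continuous_nsq.continuousAt.eventually (isOpen_ne.mem_nhds h2)
    filter_upwards [e1, e2] with y hy hy'
    exact (mem_crackedDomain hR₁ hR₁₂ hN).2 ⟨hy, Or.inl hy'⟩
  · obtain ⟨Θ, hc, h0, hΘ⟩ := exists_continuousAt_angle hR₁ θ
    have e2 := hc.eventually (Ioo_mem_nhds (by rw [h0]; exact hθ.1) (by rw [h0]; exact hθ.2))
    filter_upwards [e1, e2] with y hy hy'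
    refine (mem_crackedDomain hR₁ hR₁₂ hN).2 ⟨hy, ?_⟩
    by_cases hn : nsq y = R₁ ^ 2
    · refine Or.inr ⟨j, Θ y, hy', ?_⟩
      have := hΘ y
      rw [hn, Real.sqrt_sq hR₁.le] at this
      exact this.symm
    · exact Or.inl hn

lemma rot_mem_crackedDomain {R₁ R₂ : ℝ} (hR₁ : 0 < R₁) (hR₁₂ : R₁ < R₂) {N : ℕ} (hN : 0 < N)
    {ε : ℝ} {x : ℝ × ℝ} (hx : x ∈ crackedDomain R₁ R₂ N ε) (m : ℤ) :
    rot (2 * π * m / N) x ∈ crackedDomain R₁ R₂ N ε := by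
  obtain ⟨h1, h2⟩ := (mem_crackedDomain hR₁ hR₁₂ hN).1 hx
  refine (mem_crackedDomain hR₁ hR₁₂ hN).2 ?_
  rw [nsq_rot]
  refine ⟨h1, h2.imp id ?_⟩
  rintro ⟨j, θ, hθ, rfl⟩
  refine ⟨j + m, θ + 2 * π * m / N, ?_, rot_polarPt _ _ _⟩
  have : 2 * π * ((j + m : ℤ) : ℝ) / N = 2 * π * j / N + 2 * π * m / N := by
    push_cast; ring
  rw [this]
  constructor <;> linarith [hθ.1, hθ.2]

lemma refl₁_mem_crackedDomain {R₁ R₂ : ℝ} (hR₁ : 0 < R₁) (hR₁₂ : R₁ < R₂) {N : ℕ} (hN : 0 < N)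
    {ε : ℝ} {x : ℝ × ℝ} (hx : x ∈ crackedDomain R₁ R₂ N ε) :
    refl₁ x ∈ crackedDomain R₁ R₂ N ε := by
  obtain ⟨h1, h2⟩ := (mem_crackedDomain hR₁ hR₁₂ hN).1 hx
  refine (mem_crackedDomain hR₁ hR₁₂ hN).2 ?_
  have : nsq (refl₁ x) = nsq x := by simp [nsq, refl₁]
  rw [this]
  refine ⟨h1, h2.imp id ?_⟩
  rintro ⟨j, θ, hθ, rfl⟩
  refine ⟨-j, -θ, ?_, by simp [refl₁, polarPt]⟩
  have : 2 * π * ((-j : ℤ) : ℝ) / N = -(2 * π * j / N) := by push_cast; ring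
  rw [this]
  constructor <;> linarith [hθ.1, hθ.2]

lemma measurePreserving_of_matrix (a b c d : ℝ) (hdet : |a * d - b * c| = 1) :
    MeasurePreserving (fun x : ℝ × ℝ => (a * x.1 + b * x.2, c * x.1 + d * x.2)) volume volume := by
  refine ⟨by fun_prop, ?_⟩
  set f := Matrix.toLin (Module.Basis.finTwoProd ℝ) (Module.Basis.finTwoProd ℝ) !![a, b; c, d] with hf
  have hfe : (fun x : ℝ × ℝ => (a * x.1 + b * x.2, c * x.1 + d * x.2)) = f := by
    ext x <;> simp [hf, Matrix.toLin_finTwoProd]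
  have hd : LinearMap.det f = a * d - b * c := by
    rw [hf, LinearMap.det_toLin, Matrix.det_fin_two_of]
  have hne : LinearMap.det f ≠ 0 := by
    rw [hd]; intro h; rw [h] at hdet; simp at hdet
  rw [hfe, Measure.map_linearMap_addHaar_eq_smul_addHaar volume hne, hd, abs_inv, hdet]
  simp

lemma integral_comp_rot (α : ℝ) (F : ℝ × ℝ → ℝ) (hF : Continuous F) :
    ∫ x, F (rot α x) = ∫ x, F x := by
  have h := measurePreserving_of_matrix (Real.cos α) (-Real.sin α) (Real.sin α) (Real.cos α)
    (by rw [show Real.cos α * Real.cos α - -Real.sin α * Real.sin α = 1 by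
          nlinarith [Real.sin_sq_add_cos_sq α]]; simp)
  have he : (fun x : ℝ × ℝ => (Real.cos α * x.1 + -Real.sin α * x.2,
      Real.sin α * x.1 + Real.cos α * x.2)) = rot α := by
    ext x <;> simp [rot]; ring
  rw [he] at h
  conv_rhs => rw [← h.map_eq]
  rw [integral_map h.measurable.aemeasurable hF.aestronglyMeasurable]

lemma integral_comp_refl₁ (F : ℝ × ℝ → ℝ) (hF : Continuous F) :
    ∫ x, F (refl₁ x) = ∫ x, F x := by
  have h := measurePreserving_of_matrix 1 0 0 (-1) (by simp)
  have he : (fun x : ℝ × ℝ => (1 * x.1 + 0 * x.2, 0 * x.1 + -1 * x.2)) = refl₁ := by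
    ext x <;> simp [refl₁]
  rw [he] at h
  conv_rhs => rw [← h.map_eq]
  rw [integral_map h.measurable.aemeasurable hF.aestronglyMeasurable]

/-- Smooth compactly supported functions on the plane. -/
def IsTest (u : ℝ × ℝ → ℝ) : Prop := ContDiff ℝ (⊤ : ℕ∞) u ∧ HasCompactSupport u

lemma HasCompactSupport.fun_pow {u : ℝ × ℝ → ℝ} (hu : HasCompactSupport u) {n : ℕ} (hn : n ≠ 0) :
    HasCompactSupport (fun x => u x ^ n) :=
  hu.mono fun x hx => by
    rw [Function.mem_support] at hx ⊢
    exact fun h => hx (by rw [h, zero_pow hn])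

/-- The bilinear form `∫ ∇v·∇w − lam v w`. -/
def dform (lam : ℝ) (v w : ℝ × ℝ → ℝ) : ℝ :=
  ∫ x, (fderiv ℝ v x (1, 0) * fderiv ℝ w x (1, 0) + fderiv ℝ v x (0, 1) * fderiv ℝ w x (0, 1)
    - lam * (v x * w x))

namespace IsTest

variable {u v w : ℝ × ℝ → ℝ}

lemma continuous (hu : IsTest u) : Continuous u := hu.1.continuous

lemma differentiable (hu : IsTest u) : Differentiable ℝ u :=
  hu.1.differentiable (by simp)

lemma continuous_fderiv (hu : IsTest u) (e : ℝ × ℝ) : Continuous (fun x => fderiv ℝ u x e) :=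
  (hu.1.continuous_fderiv (by simp)).clm_apply continuous_const

lemma hasCompactSupport_fderiv (hu : IsTest u) (e : ℝ × ℝ) :
    HasCompactSupport (fun x => fderiv ℝ u x e) := hu.2.fderiv_apply (𝕜 := ℝ) e

lemma integrable_sq (hu : IsTest u) : Integrable (fun x => u x ^ 2) := by
  refine (hu.continuous.pow 2).integrable_of_hasCompactSupport ?_
  exact hu.2.fun_pow (by norm_num)

lemma integrable_gradSq (hu : IsTest u) : Integrable (gradSq u) := by
  have h : ∀ e, Integrable (fun x => fderiv ℝ u x e ^ 2) := fun e => by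
    refine ((hu.continuous_fderiv e).pow 2).integrable_of_hasCompactSupport ?_
    exact (hu.hasCompactSupport_fderiv e).fun_pow (by norm_num)
  exact (h (1, 0)).add (h (0, 1))

lemma continuous_gradSq (hu : IsTest u) : Continuous (gradSq u) :=
  ((hu.continuous_fderiv _).pow 2).add ((hu.continuous_fderiv _).pow 2)

lemma integrable_mul (hu : IsTest u) (hw : Continuous w) : Integrable (fun x => u x * w x) :=
  (hu.continuous.mul hw).integrable_of_hasCompactSupport hu.2.mul_right

lemma integrable_dform (hv : IsTest v) (hw : IsTest w) (lam : ℝ) :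
    Integrable (fun x => fderiv ℝ v x (1, 0) * fderiv ℝ w x (1, 0)
      + fderiv ℝ v x (0, 1) * fderiv ℝ w x (0, 1) - lam * (v x * w x)) := by
  have h : ∀ e, Integrable (fun x => fderiv ℝ v x e * fderiv ℝ w x e) := fun e =>
    ((hv.continuous_fderiv e).mul (hw.continuous_fderiv e)).integrable_of_hasCompactSupport
      (hv.hasCompactSupport_fderiv e).mul_right
  exact ((h _).add (h _)).sub ((hv.integrable_mul hw.continuous).const_mul lam)

lemma add (hv : IsTest v) (hw : IsTest w) : IsTest (fun x => v x + w x) :=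
  ⟨hv.1.add hw.1, hv.2.add hw.2⟩

lemma const_mul (hv : IsTest v) (c : ℝ) : IsTest (fun x => c * v x) :=
  ⟨contDiff_const.mul hv.1, hv.2.mul_left⟩

lemma zero : IsTest (fun _ => 0) := ⟨contDiff_const, HasCompactSupport.zero⟩

lemma sum {n : ℕ} {a : ℕ → ℝ} {z : ℕ → ℝ × ℝ → ℝ} (hz : ∀ j, IsTest (z j)) :
    IsTest (fun x => ∑ j ∈ Finset.range n, a j * z j x) := by
  induction n with
  | zero => simpa using zero
  | succ n ih => simpa only [Finset.sum_range_succ] using ih.add ((hz n).const_mul (a n))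

lemma integral_sq_pos (hu : IsTest u) (h0 : u ≠ 0) : 0 < ∫ x, u x ^ 2 := by
  obtain ⟨x, hx⟩ := Function.ne_iff.1 h0
  refine Continuous.integral_pos_of_hasCompactSupport_nonneg_nonzero (x := x)
    (hu.continuous.pow 2) ?_ (fun y => sq_nonneg _) ?_
  · exact hu.2.fun_pow (by norm_num)
  · simpa using hx

end IsTest

lemma dform_self {lam : ℝ} {v : ℝ × ℝ → ℝ} (hv : IsTest v) :
    dform lam v v = (∫ x, gradSq v x) - lam * ∫ x, v x ^ 2 := by
  rw [dform, ← integral_const_mul, ← integral_sub hv.integrable_gradSq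
    (hv.integrable_sq.const_mul lam)]
  congr 1; ext x; simp only [gradSq]; ring

lemma fderiv_add_const_mul {v w : ℝ × ℝ → ℝ} (hv : IsTest v) (hw : IsTest w) (c : ℝ)
    (x e : ℝ × ℝ) :
    fderiv ℝ (fun y => v y + c * w y) x e = fderiv ℝ v x e + c * fderiv ℝ w x e := by
  rw [fderiv_fun_add (hv.differentiable x) ((hw.differentiable x).const_mul c),
    fderiv_const_mul (hw.differentiable x)]
  simp

lemma dform_add_const_mul_self {lam : ℝ} {v w : ℝ × ℝ → ℝ} (hv : IsTest v) (hw : IsTest w)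
    (t : ℝ) : dform lam (fun x => v x + t * w x) (fun x => v x + t * w x) =
      dform lam w w * (t * t) + 2 * dform lam v w * t + dform lam v v := by
  have e : dform lam w w * (t * t) + 2 * dform lam v w * t + dform lam v v =
      (t * t) * dform lam w w + (2 * t) * dform lam v w + dform lam v v := by ring
  rw [e]
  simp only [dform, ← integral_const_mul, fderiv_add_const_mul hv hw]
  rw [← integral_add, ← integral_add]
  · congr 1; ext x; ring
  · exact ((hw.integrable_dform hw lam).const_mul _).add ((hv.integrable_dform hw lam).const_mul _)
  · exact hv.integrable_dform hv lam
  · exact (hw.integrable_dform hw lam).const_mul _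
  · exact (hv.integrable_dform hw lam).const_mul _

lemma dform_add_const_mul_right {lam : ℝ} {v w z : ℝ × ℝ → ℝ} (hv : IsTest v) (hw : IsTest w)
    (hz : IsTest z) (t : ℝ) :
    dform lam v (fun x => w x + t * z x) = dform lam v w + t * dform lam v z := by
  simp only [dform, ← integral_const_mul, fderiv_add_const_mul hw hz]
  rw [← integral_add (hv.integrable_dform hw lam) ((hv.integrable_dform hz lam).const_mul t)]
  congr 1; ext x; ring

lemma dform_sum_right {lam : ℝ} {v : ℝ × ℝ → ℝ} (hv : IsTest v) {n : ℕ} {a : ℕ → ℝ}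
    {z : ℕ → ℝ × ℝ → ℝ} (hz : ∀ j, IsTest (z j)) :
    dform lam v (fun x => ∑ j ∈ Finset.range n, a j * z j x) =
      ∑ j ∈ Finset.range n, a j * dform lam v (z j) := by
  induction n with
  | zero => simp [dform]
  | succ n ih =>
    simp only [Finset.sum_range_succ]
    rw [dform_add_const_mul_right hv (IsTest.sum hz) (hz n), ih]

lemma dform_sq_le {lam : ℝ} {v w : ℝ × ℝ → ℝ} (hv : IsTest v) (hw : IsTest w)
    (h : ∀ t : ℝ, 0 ≤ dform lam (fun x => v x + t * w x) (fun x => v x + t * w x)) :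
    dform lam v w ^ 2 ≤ dform lam v v * dform lam w w := by
  have := discrim_le_zero (a := dform lam w w) (b := 2 * dform lam v w) (c := dform lam v v)
    (fun t => by rw [← dform_add_const_mul_self hv hw]; exact h t)
  rw [discrim] at this
  nlinarith

lemma testFun.isTest {ω : Set (ℝ × ℝ)} {u : ℝ × ℝ → ℝ} (h : testFun ω u) : IsTest u := ⟨h.1, h.2.1⟩

lemma testFun.of_closed {ω S : Set (ℝ × ℝ)} {u : ℝ × ℝ → ℝ} (h : IsTest u) (hS : IsClosed S)
    (hSω : S ⊆ ω) (h0 : ∀ x ∉ S, u x = 0) : testFun ω u :=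
  ⟨h.1, h.2, (closure_minimal (fun x hx => by_contra fun hn => (Function.mem_support.1 hx) (h0 x hn)) hS).trans hSω⟩

lemma rayleigh_eq {ω : Set (ℝ × ℝ)} {u : ℝ × ℝ → ℝ} (h : testFun ω u) :
    rayleigh ω u = (∫ x, gradSq u x) / ∫ x, u x ^ 2 := by
  have hx0 : ∀ x ∉ ω, x ∉ tsupport u := fun x hx hx' => hx (h.2.2 hx')
  rw [rayleigh, setIntegral_eq_integral_of_forall_compl_eq_zero,
    setIntegral_eq_integral_of_forall_compl_eq_zero]
  · intro x hx; simp [image_eq_zero_of_notMem_tsupport (hx0 x hx)]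
  · intro x hx; simp [gradSq, fderiv_of_notMem_tsupport (𝕜 := ℝ) (hx0 x hx)]

lemma norm_le_of_prod (L : ℝ × ℝ →L[ℝ] ℝ) : ‖L‖ ≤ |L (1, 0)| + |L (0, 1)| := by
  refine L.opNorm_le_bound (by positivity) fun x => ?_
  have hx : x = x.1 • ((1 : ℝ), (0 : ℝ)) + x.2 • ((0 : ℝ), (1 : ℝ)) := by ext <;> simp
  have : L x = x.1 * L (1, 0) + x.2 * L (0, 1) := by
    conv_lhs => rw [hx]
    rw [map_add, map_smul, map_smul, smul_eq_mul, smul_eq_mul]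
  rw [this, Real.norm_eq_abs]
  have h1 : |x.1| ≤ ‖x‖ := norm_fst_le x
  have h2 : |x.2| ≤ ‖x‖ := norm_snd_le x
  calc |x.1 * L (1, 0) + x.2 * L (0, 1)| ≤ |x.1 * L (1, 0)| + |x.2 * L (0, 1)| := abs_add_le _ _
    _ = |x.1| * |L (1, 0)| + |x.2| * |L (0, 1)| := by rw [abs_mul, abs_mul]
    _ ≤ ‖x‖ * |L (1, 0)| + ‖x‖ * |L (0, 1)| := by gcongr
    _ = _ := by ring

/-- A form of Ladyzhenskaya's inequality. -/
lemma exists_integral_pow_four_le : ∃ C : ℝ, 0 ≤ C ∧ ∀ f : ℝ × ℝ → ℝ, IsTest f →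
    ∫ x, f x ^ 4 ≤ C * (2 * (∫ x, f x ^ 2) + ∫ x, gradSq f x) ^ 2 := by
  refine ⟨lintegralPowLePowLIntegralFDerivConst (volume : Measure (ℝ × ℝ)) 2,
    NNReal.coe_nonneg _, fun f hf => ?_⟩
  have hp : Real.HolderConjugate (Module.finrank ℝ (ℝ × ℝ)) 2 := by
    rw [Module.finrank_prod, Module.finrank_self]
    exact (by norm_num : ((1 + 1 : ℕ) : ℝ) = 2) ▸ Real.HolderConjugate.two_two
  have hf2 : IsTest (fun x => f x ^ 2) :=
    ⟨hf.1.pow 2, hf.2.fun_pow (by norm_num)⟩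
  have key := lintegral_pow_le_pow_lintegral_fderiv (volume : Measure (ℝ × ℝ))
    (hf2.1.of_le (by exact_mod_cast le_top)) hf2.2 hp
  have hint : Integrable (fun x => f x ^ 4) := by
    refine (hf.continuous.pow 4).integrable_of_hasCompactSupport ?_
    exact hf.2.fun_pow (by norm_num)
  have hl : ∫⁻ x, ‖f x ^ 2‖ₑ ^ (2 : ℝ) = ENNReal.ofReal (∫ x, f x ^ 4) := by
    rw [ofReal_integral_eq_lintegral_ofReal hint (Filter.Eventually.of_forall fun x => by positivity)]
    congr 1; ext x
    rw [Real.enorm_eq_ofReal (by positivity), ENNReal.ofReal_rpow_of_nonneg (by positivity)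
      (by norm_num)]
    congr 1
    rw [Real.rpow_two]; ring
  have hintd : Integrable (fun x => fderiv ℝ (fun y => f y ^ 2) x) :=
    (hf2.1.continuous_fderiv (by simp)).integrable_of_hasCompactSupport (hf2.2.fderiv (𝕜 := ℝ))
  have hb : ∫ x, ‖fderiv ℝ (fun y => f y ^ 2) x‖ ≤ 2 * (∫ x, f x ^ 2) + ∫ x, gradSq f x := by
    rw [← integral_const_mul, ← integral_add (hf.integrable_sq.const_mul 2) hf.integrable_gradSq]
    refine integral_mono hintd.norm ((hf.integrable_sq.const_mul 2).add hf.integrable_gradSq)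
      fun x => (norm_le_of_prod _).trans ?_
    have hd : ∀ e, fderiv ℝ (fun y => f y ^ 2) x e = 2 * f x * fderiv ℝ f x e := fun e => by
      rw [fderiv_fun_pow _ (hf.differentiable x)]; simp
    simp only [hd, gradSq, abs_mul, abs_two]
    nlinarith [sq_nonneg (|f x| - |fderiv ℝ f x (1, 0)|), sq_nonneg (|f x| - |fderiv ℝ f x (0, 1)|),
      sq_abs (f x), sq_abs (fderiv ℝ f x (1, 0)), sq_abs (fderiv ℝ f x (0, 1))]
  rw [hl, ← ofReal_integral_norm_eq_lintegral_enorm hintd,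
    ENNReal.ofReal_rpow_of_nonneg (by positivity) (by norm_num), ← ENNReal.ofReal_coe_nnreal,
    ← ENNReal.ofReal_mul (NNReal.coe_nonneg _),
    ENNReal.ofReal_le_ofReal_iff (by positivity), Real.rpow_two] at key
  refine key.trans ?_
  gcongr

lemma integral_gradSq_nonneg (u : ℝ × ℝ → ℝ) : 0 ≤ ∫ x, gradSq u x :=
  integral_nonneg fun x => by simp only [gradSq, Pi.zero_apply]; positivity

/-- The first derivative of `expNegInvGlue`. -/
def glueDeriv (t : ℝ) : ℝ := t⁻¹ ^ 2 * expNegInvGlue t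

/-- The second derivative of `expNegInvGlue`. -/
def glueDeriv₂ (t : ℝ) : ℝ := (t⁻¹ ^ 4 - 2 * t⁻¹ ^ 3) * expNegInvGlue t

lemma hasDerivAt_expNegInvGlue (t : ℝ) : HasDerivAt expNegInvGlue (glueDeriv t) t := by
  have h := expNegInvGlue.hasDerivAt_polynomial_eval_inv_mul 1 t
  convert! h using 1
  · ext x; simp
  · simp [glueDeriv]

lemma hasDerivAt_glueDeriv (t : ℝ) : HasDerivAt glueDeriv (glueDeriv₂ t) t := by
  have h := expNegInvGlue.hasDerivAt_polynomial_eval_inv_mul (Polynomial.X ^ 2) t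
  convert! h using 1
  · ext x; simp [glueDeriv]
  · simp [glueDeriv₂]; left; ring

lemma continuous_glueDeriv : Continuous glueDeriv :=
  continuous_iff_continuousAt.2 fun t => (hasDerivAt_glueDeriv t).continuousAt

lemma continuous_glueDeriv₂ : Continuous glueDeriv₂ := by
  have h := expNegInvGlue.continuous_polynomial_eval_inv_mul
    (Polynomial.X ^ 4 - 2 * Polynomial.X ^ 3)
  convert! h using 1
  ext x; simp [glueDeriv₂]

/-- A smooth radial bump supported in the Euclidean ball of centre `p` and radius `R`. -/
def radBump (β R : ℝ) (p x : ℝ × ℝ) : ℝ := expNegInvGlue (β * (R ^ 2 - nsq (x - p)))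

/-- The profile of `Δ + lam` applied to `radBump`, as a function of the squared radius. -/
def radLap (lam β R s : ℝ) : ℝ :=
  4 * β ^ 2 * s * glueDeriv₂ (β * (R ^ 2 - s)) - 4 * β * glueDeriv (β * (R ^ 2 - s))
    + lam * expNegInvGlue (β * (R ^ 2 - s))

lemma continuous_radLap (lam β R : ℝ) : Continuous (radLap lam β R) := by
  have h0 : Continuous expNegInvGlue := expNegInvGlue.contDiff (n := 0).continuous
  have h1 := continuous_glueDeriv
  have h2 := continuous_glueDeriv₂
  unfold radLap
  fun_prop

lemma radLap_eq_zero {lam β R s : ℝ} (hβ : 0 < β) (hs : R ^ 2 ≤ s) : radLap lam β R s = 0 := by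
  have : β * (R ^ 2 - s) ≤ 0 := mul_nonpos_of_nonneg_of_nonpos hβ.le (by linarith)
  simp [radLap, glueDeriv, glueDeriv₂, expNegInvGlue.zero_of_nonpos this]

lemma radLap_pos {lam ρ R s : ℝ} (hlam : 0 ≤ lam) (hρ : 0 < ρ) (hρR : ρ < R) (hs : ρ ^ 2 ≤ s)
    (hsR : s < R ^ 2) : 0 < radLap lam (ρ ^ 2 / (8 * R ^ 4)) R s := by
  have hR : 0 < R := hρ.trans hρR
  set β := ρ ^ 2 / (8 * R ^ 4) with hβ
  have hβ0 : 0 < β := by positivity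
  set t := β * (R ^ 2 - s) with ht
  have ht0 : 0 < t := mul_pos hβ0 (by linarith)
  have hβR : β * R ^ 4 = ρ ^ 2 / 8 := by rw [hβ]; field_simp
  have hρR2 : ρ ^ 2 < R ^ 2 := by nlinarith
  have hs0 : 0 < s := lt_of_lt_of_le (by positivity) hs
  have htR : t ≤ β * R ^ 2 := by rw [ht]; nlinarith
  have hβR2 : β * R ^ 2 ≤ 1 / 8 := by
    have : β * R ^ 2 * R ^ 2 < 1 / 8 * R ^ 2 := by nlinarith
    exact (lt_of_mul_lt_mul_right this (by positivity)).le
  have hE := expNegInvGlue.pos_of_pos ht0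
  have hmain : 0 < s * β * (1 - 2 * t) - t ^ 2 := by
    have h1 : t ^ 2 ≤ β * (ρ ^ 2 / 8) := by
      rw [← hβR]
      calc t ^ 2 ≤ (β * R ^ 2) ^ 2 := by gcongr
        _ = _ := by ring
    have h2 : ρ ^ 2 * β * (3 / 4) ≤ s * β * (1 - 2 * t) := by
      gcongr
      linarith
    nlinarith [mul_pos (pow_pos hρ 2) hβ0]
  have hid : radLap lam β R s = 4 * β * expNegInvGlue t * t⁻¹ ^ 4 *
      (s * β * (1 - 2 * t) - t ^ 2) + lam * expNegInvGlue t := by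
    simp only [radLap, ← ht, glueDeriv, glueDeriv₂]
    field_simp
  rw [hid]
  have := mul_pos (mul_pos (mul_pos (mul_pos four_pos hβ0) hE) (pow_pos (inv_pos.2 ht0) 4)) hmain
  have h2 := mul_nonneg hlam hE.le
  linarith

lemma radBump_eq_zero {β R : ℝ} {p x : ℝ × ℝ} (hβ : 0 < β) (hx : R ^ 2 ≤ nsq (x - p)) :
    radBump β R p x = 0 :=
  expNegInvGlue.zero_of_nonpos (mul_nonpos_of_nonneg_of_nonpos hβ.le (by linarith))

lemma isClosed_nsq_sub_le (p : ℝ × ℝ) (s : ℝ) : IsClosed {x | nsq (x - p) ≤ s} :=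
  isClosed_le (continuous_nsq.comp (continuous_id.sub continuous_const)) continuous_const

lemma isTest_radBump {β R : ℝ} (hβ : 0 < β) (hR : 0 < R) (p : ℝ × ℝ) : IsTest (radBump β R p) := by
  constructor
  · unfold radBump nsq
    refine expNegInvGlue.contDiff.comp ?_
    fun_prop
  · refine HasCompactSupport.of_support_subset_isCompact (isCompact_closedBall p R) fun x hx => ?_
    have h : nsq (x - p) < R ^ 2 := by
      by_contra hn
      exact hx (radBump_eq_zero hβ (not_lt.1 hn))
    simp only [nsq, Prod.fst_sub, Prod.snd_sub] at h
    rw [mem_closedBall_iff_norm, Prod.norm_def, max_le_iff]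
    exact ⟨abs_le_of_sq_le_sq (by simp; nlinarith [sq_nonneg (x.2 - p.2)]) hR.le,
      abs_le_of_sq_le_sq (by simp; nlinarith [sq_nonneg (x.1 - p.1)]) hR.le⟩

lemma hasFDerivAt_radArg (β R : ℝ) (p x : ℝ × ℝ) :
    HasFDerivAt (fun y : ℝ × ℝ => β * (R ^ 2 - nsq (y - p)))
      (-(2 * β * (x.1 - p.1)) • ContinuousLinearMap.fst ℝ ℝ ℝ
        - (2 * β * (x.2 - p.2)) • ContinuousLinearMap.snd ℝ ℝ ℝ) x := by
  have h1 : HasFDerivAt (fun y : ℝ × ℝ => y.1 - p.1) (ContinuousLinearMap.fst ℝ ℝ ℝ) x :=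
    hasFDerivAt_fst.sub_const _
  have h2 : HasFDerivAt (fun y : ℝ × ℝ => y.2 - p.2) (ContinuousLinearMap.snd ℝ ℝ ℝ) x :=
    hasFDerivAt_snd.sub_const _
  have h := (((h1.mul h1).add (h2.mul h2)).const_sub (R ^ 2)).const_mul β
  convert! h using 1
  · ext y; simp only [nsq, Pi.add_apply, Pi.mul_apply, Prod.fst_sub, Prod.snd_sub]; ring
  · ext <;> simp <;> ring

lemma fderiv_radBump (β R : ℝ) (p x e : ℝ × ℝ) :
    fderiv ℝ (radBump β R p) x e = glueDeriv (β * (R ^ 2 - nsq (x - p))) *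
      (-(2 * β * (x.1 - p.1)) * e.1 - (2 * β * (x.2 - p.2)) * e.2) := by
  have h := (hasDerivAt_expNegInvGlue (β * (R ^ 2 - nsq (x - p)))).comp_hasFDerivAt x
    (hasFDerivAt_radArg β R p x)
  have h' : HasFDerivAt (radBump β R p) _ x := h
  rw [h'.fderiv]; simp

lemma dform_radBump {lam β R : ℝ} {v : ℝ × ℝ → ℝ} (hv : IsTest v) (hβ : 0 < β) (hR : 0 < R)
    (p : ℝ × ℝ) :
    dform lam v (radBump β R p) = -∫ x, v x * radLap lam β R (nsq (x - p)) := by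
  have hz := isTest_radBump hβ hR p
  have hzd : ∀ e, IsTest (fun x => fderiv ℝ (radBump β R p) x e) := fun e =>
    ⟨(hz.1.fderiv_right (m := (⊤ : ℕ∞)) (by simp)).clm_apply contDiff_const,
      hz.hasCompactSupport_fderiv e⟩
  have ibp : ∀ e, ∫ x, fderiv ℝ v x e * fderiv ℝ (radBump β R p) x e =
      -∫ x, v x * fderiv ℝ (fun y => fderiv ℝ (radBump β R p) y e) x e := fun e => by
    rw [integral_mul_fderiv_eq_neg_fderiv_mul_of_integrable (f := v), neg_neg]
    · exact ((hv.continuous_fderiv e).mul (hz.continuous_fderiv e)).integrable_of_hasCompactSupport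
        (hv.hasCompactSupport_fderiv e).mul_right
    · exact hv.integrable_mul ((hzd e).continuous_fderiv e)
    · exact hv.integrable_mul (hz.continuous_fderiv e)
    · exact fun x _ => hv.differentiable x
    · exact fun x _ => (hzd e).differentiable x
  have hint : ∀ e, Integrable (fun x => fderiv ℝ v x e * fderiv ℝ (radBump β R p) x e) := fun e =>
    ((hv.continuous_fderiv e).mul (hz.continuous_fderiv e)).integrable_of_hasCompactSupport
        (hv.hasCompactSupport_fderiv e).mul_right
  have hint2 : ∀ e, Integrable
      (fun x => v x * fderiv ℝ (fun y => fderiv ℝ (radBump β R p) y e) x e) := fun e =>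
    hv.integrable_mul ((hzd e).continuous_fderiv e)
  have hd : ∀ x e, fderiv ℝ (fun y => fderiv ℝ (radBump β R p) y e) x e =
      glueDeriv₂ (β * (R ^ 2 - nsq (x - p))) *
        (-(2 * β * (x.1 - p.1)) * e.1 - (2 * β * (x.2 - p.2)) * e.2) ^ 2
      - 2 * β * (e.1 ^ 2 + e.2 ^ 2) * glueDeriv (β * (R ^ 2 - nsq (x - p))) := fun x e => by
    simp only [fderiv_radBump]
    have h1 := (hasDerivAt_glueDeriv (β * (R ^ 2 - nsq (x - p)))).comp_hasFDerivAt x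
      (hasFDerivAt_radArg β R p x)
    have h2 : HasFDerivAt (fun y : ℝ × ℝ =>
        -(2 * β * (y.1 - p.1)) * e.1 - (2 * β * (y.2 - p.2)) * e.2)
        (-(2 * β * e.1) • ContinuousLinearMap.fst ℝ ℝ ℝ
          - (2 * β * e.2) • ContinuousLinearMap.snd ℝ ℝ ℝ) x := by
      have a := (((hasFDerivAt_fst (𝕜 := ℝ) (p := x)).sub_const p.1).const_mul (-(2 * β * e.1))).sub
        (((hasFDerivAt_snd (𝕜 := ℝ) (p := x)).sub_const p.2).const_mul (2 * β * e.2))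
      convert! a using 1
      ext y; simp; ring
    have h3 : HasFDerivAt (fun y => glueDeriv (β * (R ^ 2 - nsq (y - p))) *
      (-(2 * β * (y.1 - p.1)) * e.1 - (2 * β * (y.2 - p.2)) * e.2)) _ x := h1.mul h2
    rw [h3.fderiv]; simp; ring
  have hsplit : dform lam v (radBump β R p) =
      (∫ x, fderiv ℝ v x (1, 0) * fderiv ℝ (radBump β R p) x (1, 0))
      + (∫ x, fderiv ℝ v x (0, 1) * fderiv ℝ (radBump β R p) x (0, 1))
      - ∫ x, lam * (v x * radBump β R p x) := by
    rw [← integral_add (hint _) (hint _)]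
    exact integral_sub ((hint _).add (hint _)) ((hv.integrable_mul hz.continuous).const_mul lam)
  rw [hsplit, ibp, ibp, ← integral_neg, ← integral_neg, ← integral_neg, ← integral_add,
    ← integral_sub]
  · congr 1; ext x
    rw [hd, hd]
    simp only [radLap, radBump]
    have : nsq (x - p) = (x.1 - p.1) ^ 2 + (x.2 - p.2) ^ 2 := rfl
    have h2 : ∀ g : ℝ, 4 * β ^ 2 * nsq (x - p) * g =
      4 * β ^ 2 * ((x.1 - p.1) ^ 2 + (x.2 - p.2) ^ 2) * g := fun g => by rw [this]
    rw [h2]; ring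
  · exact (hint2 _).neg.add (hint2 _).neg
  · exact (hv.integrable_mul hz.continuous).const_mul lam
  · exact (hint2 _).neg
  · exact (hint2 _).neg

/-- The function equal to `sin (2πj/N + φ)` on the `j`-th sector of opening `2π/N`, where the
sectors are counted from the half-line of angle `a`. -/
def secCoef (N : ℕ) (a φ : ℝ) (x : ℝ × ℝ) : ℝ :=
  Real.sin (2 * π / N * ⌊(ang x - a) * N / (2 * π)⌋ + φ)

/-- The lines through the origin separating the sectors. -/
def OnLines (N : ℕ) (a : ℝ) (x : ℝ × ℝ) : Prop :=
  ∃ r : ℝ, ∃ j : ℤ, x = polarPt r (a + 2 * π * j / N)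

lemma polarPt_zero (θ : ℝ) : polarPt 0 θ = 0 := by simp [polarPt]

lemma onLines_zero (N : ℕ) (a : ℝ) : OnLines N a 0 := ⟨0, 0, (polarPt_zero _).symm⟩

lemma exists_polarPt_of_ne_zero {x : ℝ × ℝ} (hx : x ≠ 0) : ∃ r θ, 0 < r ∧ x = polarPt r θ := by
  refine ⟨√(nsq x), ang x, ?_, (polarPt_ang x).symm⟩
  refine lt_of_le_of_ne (Real.sqrt_nonneg _) fun h => hx ?_
  rw [← polarPt_ang x, ← h, polarPt_zero]

lemma ang_polarPt {r : ℝ} (hr : 0 < r) (θ : ℝ) : ∃ k : ℤ, ang (polarPt r θ) = θ + 2 * π * k := by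
  have h := polarPt_ang (polarPt r θ)
  rw [nsq_polarPt, Real.sqrt_sq hr.le] at h
  exact angle_eq_of_polarPt_eq hr.ne' h

lemma secCoef_polarPt {N : ℕ} (hN : 0 < N) (a φ : ℝ) {r : ℝ} (hr : 0 < r) (θ : ℝ) :
    secCoef N a φ (polarPt r θ) = Real.sin (2 * π / N * ⌊(θ - a) * N / (2 * π)⌋ + φ) := by
  obtain ⟨k, hk⟩ := ang_polarPt hr θ
  have hN' : (N : ℝ) ≠ 0 := by positivity
  have h1 : (θ + 2 * π * k - a) * N / (2 * π) = (θ - a) * N / (2 * π) + ((k * N : ℤ) : ℝ) := by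
    push_cast; field_simp; ring
  rw [secCoef, hk, h1, Int.floor_add_intCast]
  rw [← Real.sin_add_int_mul_two_pi (2 * π / N * ⌊(θ - a) * N / (2 * π)⌋ + φ) k]
  congr 1
  push_cast; field_simp; ring

lemma secCoef_sq_add (N : ℕ) (a : ℝ) (x : ℝ × ℝ) :
    secCoef N a 0 x ^ 2 + secCoef N a (π / 2) x ^ 2 = 1 := by
  simp only [secCoef, Real.sin_add_pi_div_two, add_zero, Real.sin_sq_add_cos_sq]

lemma abs_secCoef_le (N : ℕ) (a φ : ℝ) (x : ℝ × ℝ) : |secCoef N a φ x| ≤ 1 := Real.abs_sin_le_one _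

lemma secCoef_rot {N : ℕ} (hN : 0 < N) (a φ : ℝ) {x : ℝ × ℝ} (hx : x ≠ 0) (j : ℤ) :
    secCoef N a φ (rot (2 * π / N * j) x) = secCoef N a (φ + 2 * π / N * j) x := by
  obtain ⟨r, θ, hr, rfl⟩ := exists_polarPt_of_ne_zero hx
  have hN' : (N : ℝ) ≠ 0 := by positivity
  rw [rot_polarPt, secCoef_polarPt hN _ _ hr, secCoef_polarPt hN _ _ hr]
  have h1 : (θ + 2 * π / N * j - a) * N / (2 * π) = (θ - a) * N / (2 * π) + (j : ℝ) := by
    field_simp; ring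
  rw [h1, Int.floor_add_intCast]
  congr 1; push_cast; ring

lemma secCoef_eventuallyEq {N : ℕ} (hN : 0 < N) (a φ : ℝ) {x : ℝ × ℝ} (hx : ¬ OnLines N a x) :
    ∀ᶠ y in nhds x, secCoef N a φ y = secCoef N a φ x := by
  obtain ⟨r, θ, hr, rfl⟩ := exists_polarPt_of_ne_zero (x := x)
    (fun h => hx (h ▸ onLines_zero N a))
  have hN' : (N : ℝ) ≠ 0 := by positivity
  obtain ⟨Θ, hc, h0, hΘ⟩ := exists_continuousAt_angle hr θ
  set m := ⌊(θ - a) * N / (2 * π)⌋ with hm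
  have hne : (m : ℝ) ≠ (θ - a) * N / (2 * π) := fun h => hx ⟨r, m, by
    rw [h]; congr 1; field_simp; ring⟩
  have hlt : (m : ℝ) < (θ - a) * N / (2 * π) := lt_of_le_of_ne (Int.floor_le _) hne
  have hlt2 : (θ - a) * N / (2 * π) < m + 1 := Int.lt_floor_add_one _
  have hcont : ContinuousAt (fun y => (Θ y - a) * N / (2 * π)) (polarPt r θ) :=
    ((hc.sub continuousAt_const).mul continuousAt_const).div_const _
  have e1 := hcont.eventually (Ioo_mem_nhds (a := (m : ℝ)) (b := m + 1)
    (by simpa only [h0] using hlt) (by simpa only [h0] using hlt2))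
  have e2 : ∀ᶠ y in nhds (polarPt r θ), 0 < nsq y :=
    continuous_nsq.continuousAt.eventually (Ioi_mem_nhds (by rw [nsq_polarPt]; positivity))
  filter_upwards [e1, e2] with y hy hy2
  conv_lhs => rw [← hΘ y]
  rw [secCoef_polarPt hN _ _ (Real.sqrt_pos.2 hy2), secCoef_polarPt hN _ _ hr, ← hm,
    Int.floor_eq_iff.2 ⟨hy.1.le, hy.2⟩]

section
variable {N : ℕ} {a : ℝ} {f : ℝ × ℝ → ℝ}

lemma secCoef_mul_eventuallyEq (hN : 0 < N) (hf0 : ∀ x, OnLines N a x → f =ᶠ[nhds x] 0) (φ : ℝ)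
    (x : ℝ × ℝ) : (fun y => secCoef N a φ y * f y) =ᶠ[nhds x] fun y => secCoef N a φ x * f y := by
  by_cases hx : OnLines N a x
  · filter_upwards [hf0 x hx] with y hy
    simp [hy]
  · filter_upwards [secCoef_eventuallyEq hN a φ hx] with y hy
    rw [hy]

lemma isTest_secCoef_mul (hN : 0 < N) (hf : IsTest f)
    (hf0 : ∀ x, OnLines N a x → f =ᶠ[nhds x] 0) (φ : ℝ) :
    IsTest (fun y => secCoef N a φ y * f y) := by
  refine ⟨contDiff_iff_contDiffAt.2 fun x => ?_, hf.2.mul_left⟩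
  exact (contDiffAt_const.mul hf.1.contDiffAt).congr_of_eventuallyEq
    (secCoef_mul_eventuallyEq hN hf0 φ x)

lemma gradSq_secCoef_mul (hN : 0 < N) (hf : IsTest f)
    (hf0 : ∀ x, OnLines N a x → f =ᶠ[nhds x] 0) (φ : ℝ) (x : ℝ × ℝ) :
    gradSq (fun y => secCoef N a φ y * f y) x = secCoef N a φ x ^ 2 * gradSq f x := by
  simp only [gradSq, (secCoef_mul_eventuallyEq hN hf0 φ x).fderiv_eq]
  rw [fderiv_const_mul (hf.differentiable x)]
  simp; ring

lemma testFun_secCoef_mul {ω : Set (ℝ × ℝ)} (hN : 0 < N) (hf : testFun ω f)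
    (hf0 : ∀ x, OnLines N a x → f =ᶠ[nhds x] 0) (φ : ℝ) :
    testFun ω (fun y => secCoef N a φ y * f y) :=
  testFun.of_closed (isTest_secCoef_mul hN hf.isTest hf0 φ) (isClosed_tsupport f) hf.2.2
    fun x hx => by rw [image_eq_zero_of_notMem_tsupport hx, mul_zero]

lemma comp_rot_neg (hrot : ∀ x, f (rot (2 * π / N) x) = f x) (x : ℝ × ℝ) :
    f (rot (-(2 * π / N)) x) = f x := by
  rw [← hrot (rot _ x), rot_rot]; simp [rot_zero']

lemma comp_rot_nat (hrot : ∀ x, f (rot (2 * π / N) x) = f x) (j : ℕ) (x : ℝ × ℝ) :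
    f (rot (2 * π / N * j) x) = f x := by
  induction j with
  | zero => simp [rot_zero']
  | succ j ih =>
    have : rot (2 * π / N * ((j + 1 : ℕ) : ℝ)) x = rot (2 * π / N) (rot (2 * π / N * j) x) := by
      rw [rot_rot]; congr 1; push_cast; ring
    rw [this, hrot, ih]

lemma inAClass_secCoef_mul (hN : 0 < N) (hrot : ∀ x, f (rot (2 * π / N) x) = f x)
    (hf0 : ∀ x, OnLines N a x → f =ᶠ[nhds x] 0) (φ : ℝ) :
    inAClass N 1 (fun y => secCoef N a φ y * f y) := by
  intro x
  have h2 : rot (-(2 * (2 * π / N))) x = rot (-(2 * π / N)) (rot (-(2 * π / N)) x) := by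
    rw [rot_rot]; congr 1; ring
  by_cases hx : x = 0
  · subst hx
    have : f 0 = 0 := (hf0 0 (onLines_zero N a)).eq_of_nhds
    simp [rot_zero_pt, this]
  have c1 := secCoef_rot hN a φ hx (-1)
  have c2 := secCoef_rot hN a φ hx (-2)
  rw [show 2 * π / N * ((-1 : ℤ) : ℝ) = -(2 * π / N) by push_cast; ring] at c1
  rw [show 2 * π / N * ((-2 : ℤ) : ℝ) = -(2 * (2 * π / N)) by push_cast; ring] at c2
  have f2 : f (rot (-(2 * (2 * π / N))) x) = f x := by
    rw [h2, comp_rot_neg hrot, comp_rot_neg hrot]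
  simp only [c1, c2, f2, comp_rot_neg hrot, Nat.cast_one, mul_one]
  generalize hA : 2 * π / N = A
  simp only [secCoef, hA]
  generalize (A * _ : ℝ) = B
  rw [show B + (φ + -A) = (B + φ) - A by ring, show B + (φ + -(2 * A)) = (B + φ) - 2 * A by ring,
    Real.sin_sub, Real.sin_sub, Real.sin_two_mul, Real.cos_two_mul]
  ring

end

lemma inAClass.add_const_mul {N l : ℕ} {v w : ℝ × ℝ → ℝ} (hv : inAClass N l v)
    (hw : inAClass N l w) (t : ℝ) : inAClass N l (fun x => v x + t * w x) := fun x => by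
  linear_combination hv x + t * hw x

lemma testFun.add_const_mul {ω : Set (ℝ × ℝ)} {v w : ℝ × ℝ → ℝ} (hv : testFun ω v)
    (hw : testFun ω w) (t : ℝ) : testFun ω (fun x => v x + t * w x) := by
  refine testFun.of_closed (hv.isTest.add (hw.isTest.const_mul t))
    ((isClosed_tsupport v).union (isClosed_tsupport w)) (union_subset hv.2.2 hw.2.2) fun x hx => ?_
  rw [mem_union, not_or] at hx
  simp [image_eq_zero_of_notMem_tsupport hx.1, image_eq_zero_of_notMem_tsupport hx.2]

lemma sum_range_shift {N : ℕ} (h : ℕ → ℝ) (hp : h N = h 0) :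
    ∑ j ∈ Finset.range N, h (j + 1) = ∑ j ∈ Finset.range N, h j := by
  have h1 := Finset.sum_range_succ h N
  have h2 := Finset.sum_range_succ' h N
  linarith

lemma sum_cos_mul_sin {N : ℕ} (hN : 3 ≤ N) (t : ℝ) :
    ∑ j ∈ Finset.range N, Real.cos (2 * π / N * j) * Real.sin (t + 2 * π / N * j) =
      N / 2 * Real.sin t := by
  have hN0 : (0 : ℝ) < N := by exact_mod_cast (by omega : 0 < N)
  have hN3 : (3 : ℝ) ≤ N := by exact_mod_cast hN
  set A := 2 * π / N with hA
  have hs : 0 < Real.sin A := by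
    apply Real.sin_pos_of_pos_of_lt_pi (by positivity)
    rw [hA, div_lt_iff₀ hN0]; nlinarith [Real.pi_pos]
  have htel : ∑ j ∈ Finset.range N, 2 * Real.sin A * Real.sin (t + 2 * A * j) = 0 := by
    have : ∀ j : ℕ, 2 * Real.sin A * Real.sin (t + 2 * A * j) =
        Real.cos (t + 2 * A * j - A) - Real.cos (t + 2 * A * ((j + 1 : ℕ) : ℝ) - A) := fun j => by
      rw [show t + 2 * A * ((j + 1 : ℕ) : ℝ) - A = (t + 2 * A * j) + A by push_cast; ring,
        Real.cos_add, Real.cos_sub]; ring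
    rw [Finset.sum_congr rfl fun j _ => this j,
      Finset.sum_range_sub' (fun j : ℕ => Real.cos (t + 2 * A * (j : ℝ) - A))]
    have : t + 2 * A * (N : ℝ) - A = (t + 2 * A * ((0 : ℕ) : ℝ) - A) + (2 : ℕ) * (2 * π) := by
      rw [hA]; field_simp; push_cast; ring
    rw [this, Real.cos_add_nat_mul_two_pi, sub_self]
  rw [← Finset.mul_sum] at htel
  have h0 : ∑ j ∈ Finset.range N, Real.sin (t + 2 * A * j) = 0 :=
    (mul_eq_zero.1 htel).resolve_left (by positivity)
  have hterm : ∀ j : ℕ, Real.cos (A * j) * Real.sin (t + A * j) =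
      1 / 2 * Real.sin (t + 2 * A * j) + 1 / 2 * Real.sin t := fun j => by
    rw [show t + 2 * A * j = (t + A * j) + A * j by ring]
    have h1 := Real.sin_add (t + A * j) (A * j)
    have h2 := Real.sin_sub (t + A * j) (A * j)
    rw [show t + A * j - A * j = t by ring] at h2
    rw [h1, h2]; ring
  rw [Finset.sum_congr rfl fun j _ => hterm j, Finset.sum_add_distrib, ← Finset.mul_sum, h0]
  simp; ring

/-- The `A_1`-symmetrization of a radial bump. -/
def symBump (N : ℕ) (β R : ℝ) (p x : ℝ × ℝ) : ℝ :=
  ∑ j ∈ Finset.range N, Real.cos (2 * π / N * j) * radBump β R (rot (2 * π / N * j) p) x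

lemma inAClass_symBump {N : ℕ} (hN : 0 < N) (β R : ℝ) (p : ℝ × ℝ) :
    inAClass N 1 (symBump N β R p) := by
  intro x
  have hN0 : (N : ℝ) ≠ 0 := by positivity
  simp only [Nat.cast_one, mul_one]
  have hper : ∀ k : ℕ, Real.cos (2 * π / N * ((N : ℕ) - (k : ℝ))) =
      Real.cos (2 * π / N * (((0 : ℕ) : ℝ) - k)) := fun k => by
    rw [show 2 * π / N * ((N : ℕ) - (k : ℝ)) = 2 * π / N * (((0 : ℕ) : ℝ) - k) + 2 * π by
      field_simp; push_cast; ring, Real.cos_add_two_pi]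
  have hperZ : rot (2 * π / N * (N : ℕ)) p = rot (2 * π / N * ((0 : ℕ) : ℝ)) p := by
    rw [show 2 * π / N * (N : ℕ) = 2 * π by field_simp]; simp [rot]
  set A := 2 * π / N with hA
  have shift : ∀ (B : ℝ) (j : ℕ), radBump β R (rot (A * j) p) (rot (-B) x) =
      radBump β R (rot (A * j + B) p) x := fun B j => by
    simp only [radBump]
    rw [show rot (A * j) p = rot (-B) (rot (A * j + B) p) by rw [rot_rot]; congr 1; ring,
      nsq_rot_sub]
  have s1 := sum_range_shift (N := N) (fun j : ℕ => Real.cos (A * (j - (1 : ℕ))) *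
    radBump β R (rot (A * j) p) x) (by simp only [hper, hperZ])
  have s2 := sum_range_shift (N := N) (fun j : ℕ => Real.cos (A * (j - (2 : ℕ))) *
    radBump β R (rot (A * j) p) x) (by simp only [hper, hperZ])
  have hperZ1 : rot (A * ((N + 1 : ℕ) : ℝ)) p = rot (A * ((0 + 1 : ℕ) : ℝ)) p := by
    have : ∀ n : ℕ, rot (A * ((n + 1 : ℕ) : ℝ)) p = rot A (rot (A * n) p) := fun n => by
      rw [rot_rot]; congr 1; push_cast; ring
    rw [this, this, hperZ]
  have hper1 : Real.cos (A * (((N + 1 : ℕ) : ℝ) - (2 : ℕ))) =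
      Real.cos (A * (((0 + 1 : ℕ) : ℝ) - (2 : ℕ))) := by
    have := hper 1
    rw [show ((N + 1 : ℕ) : ℝ) - (2 : ℕ) = (N : ℝ) - (1 : ℕ) by push_cast; ring, this]
    congr 2; push_cast; ring
  have s3 := sum_range_shift (N := N) (fun j : ℕ => Real.cos (A * (((j + 1 : ℕ) : ℝ) - (2 : ℕ))) *
    radBump β R (rot (A * ((j + 1 : ℕ) : ℝ)) p) x) (by simp only [hper1, hperZ1])
  have e1 : symBump N β R p (rot (-A) x) =
      ∑ j ∈ Finset.range N, Real.cos (A * (j - (1 : ℕ))) * radBump β R (rot (A * j) p) x := by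
    rw [← s1, symBump]
    refine Finset.sum_congr rfl fun j _ => ?_
    rw [← hA, shift]
    congr 2
    · push_cast; ring
    · congr 1; push_cast; ring
  have e2 : symBump N β R p (rot (-(2 * A)) x) =
      ∑ j ∈ Finset.range N, Real.cos (A * (j - (2 : ℕ))) * radBump β R (rot (A * j) p) x := by
    rw [← s2, ← s3, symBump]
    refine Finset.sum_congr rfl fun j _ => ?_
    rw [← hA, shift]
    congr 2
    · push_cast; ring
    · congr 1; push_cast; ring
  rw [e1, e2, symBump, Finset.mul_sum, ← Finset.sum_sub_distrib, ← Finset.sum_add_distrib]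
  refine Finset.sum_eq_zero fun j _ => ?_
  rw [← hA, show A * ((j : ℝ) - (1 : ℕ)) = A * j - A by push_cast; ring,
    show A * ((j : ℝ) - (2 : ℕ)) = A * j - 2 * A by push_cast; ring,
    Real.cos_sub, Real.cos_sub, Real.sin_two_mul, Real.cos_two_mul]
  ring

lemma testFun_symBump {ω : Set (ℝ × ℝ)} {N : ℕ} {β R : ℝ} (hβ : 0 < β) (hR : 0 < R) {p : ℝ × ℝ}
    (hω : ∀ x ∈ ω, ∀ j : ℕ, rot (2 * π / N * j) x ∈ ω)
    (hp : ∀ x, nsq (x - p) ≤ R ^ 2 → x ∈ ω) : testFun ω (symBump N β R p) := by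
  refine testFun.of_closed (S := ⋃ j ∈ Finset.range N, {x | nsq (x - rot (2 * π / N * j) p) ≤ R ^ 2})
    (IsTest.sum fun j => isTest_radBump hβ hR _) ?_ ?_ ?_
  · exact isClosed_biUnion_finset fun j _ => isClosed_nsq_sub_le _ _
  · refine iUnion₂_subset fun j _ x hx => ?_
    have hx' : nsq (x - rot (2 * π / N * j) p) ≤ R ^ 2 := hx
    have hxe : x = rot (2 * π / N * j) (rot (-(2 * π / N * j)) x) := by
      rw [rot_rot]; simp [rot_zero']
    rw [hxe] at hx' ⊢
    rw [nsq_rot_sub] at hx'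
    exact hω _ (hp _ hx') j
  · intro x hx
    refine Finset.sum_eq_zero fun j hj => ?_
    rw [radBump_eq_zero hβ, mul_zero]
    by_contra hn
    exact hx (mem_iUnion₂.2 ⟨j, hj, (not_le.1 hn).le⟩)

lemma dform_symBump {N : ℕ} (hN : 3 ≤ N) {a lam β R : ℝ} {f : ℝ × ℝ → ℝ} (hf : IsTest f)
    (hrot : ∀ x, f (rot (2 * π / N) x) = f x)
    (hf0 : ∀ x, OnLines N a x → f =ᶠ[nhds x] 0) (hβ : 0 < β) (hR : 0 < R) (p : ℝ × ℝ) :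
    dform lam (fun y => secCoef N a 0 y * f y) (symBump N β R p) =
      -(N / 2 * ∫ x, secCoef N a 0 x * f x * radLap lam β R (nsq (x - p))) := by
  have hN0 : 0 < N := by omega
  have hv := fun φ => isTest_secCoef_mul hN0 hf hf0 φ
  have hf00 : f 0 = 0 := (hf0 0 (onLines_zero N a)).eq_of_nhds
  have hKc : Continuous fun x : ℝ × ℝ => radLap lam β R (nsq (x - p)) :=
    (continuous_radLap _ _ _).comp (continuous_nsq.comp (continuous_id.sub continuous_const))
  have hterm : ∀ j : ℕ, dform lam (fun y => secCoef N a 0 y * f y)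
      (radBump β R (rot (2 * π / N * j) p)) =
      -∫ x, secCoef N a (2 * π / N * j) x * f x * radLap lam β R (nsq (x - p)) := fun j => by
    rw [dform_radBump (hv 0) hβ hR, ← integral_comp_rot (2 * π / N * j)]
    · congr 1
      congr 1; ext x
      rw [nsq_rot_sub, comp_rot_nat hrot]
      by_cases hx : x = 0
      · simp [hx, hf00]
      · have := secCoef_rot hN0 a 0 hx j
        rw [zero_add] at this
        rw [show ((j : ℝ)) = ((j : ℤ) : ℝ) by norm_cast, this]
    · exact (hv 0).continuous.mul ((continuous_radLap _ _ _).comp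
        (continuous_nsq.comp (continuous_id.sub continuous_const)))
  have hs : dform lam (fun y => secCoef N a 0 y * f y) (symBump N β R p) =
      ∑ j ∈ Finset.range N, Real.cos (2 * π / N * j) * dform lam (fun y => secCoef N a 0 y * f y)
        (radBump β R (rot (2 * π / N * j) p)) :=
    dform_sum_right (hv 0) (a := fun j => Real.cos (2 * π / N * j))
      (z := fun j => radBump β R (rot (2 * π / N * j) p)) fun j => isTest_radBump hβ hR _
  rw [hs]
  simp only [hterm, mul_neg, Finset.sum_neg_distrib, ← integral_const_mul]
  rw [← integral_finsetSum _ fun j _ => ((hv _).integrable_mul hKc).const_mul _]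
  congr 2; ext x
  have := sum_cos_mul_sin hN (2 * π / N * ⌊(ang x - a) * N / (2 * π)⌋)
  simp only [secCoef, add_zero]
  rw [← mul_assoc, ← mul_assoc, ← this, Finset.sum_mul, Finset.sum_mul]
  refine Finset.sum_congr rfl fun j _ => ?_
  ring

lemma rayleigh_nonneg {ω : Set (ℝ × ℝ)} {u : ℝ × ℝ → ℝ} (h : testFun ω u) : 0 ≤ rayleigh ω u := by
  rw [rayleigh_eq h]
  exact div_nonneg (integral_gradSq_nonneg u) (integral_nonneg fun x => sq_nonneg _)

lemma symLambda1_nonneg (ω : Set (ℝ × ℝ)) (N l : ℕ) : 0 ≤ symLambda1 ω N l := by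
  refine Real.sInf_nonneg ?_
  rintro r ⟨u, hu, -, -, rfl⟩
  exact rayleigh_nonneg hu

lemma dform_self_nonneg {ω : Set (ℝ × ℝ)} {N l : ℕ} {lam : ℝ} (hlam : lam ≤ symLambda1 ω N l)
    {v : ℝ × ℝ → ℝ} (hv : testFun ω v) (hvc : inAClass N l v) : 0 ≤ dform lam v v := by
  rw [dform_self hv.isTest]
  by_cases h0 : v = 0
  · have := integral_gradSq_nonneg v
    simpa [h0] using this
  · have hpos := hv.isTest.integral_sq_pos h0
    have h1 : symLambda1 ω N l ≤ rayleigh ω v := by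
      refine csInf_le ⟨0, ?_⟩ ⟨v, hv, hvc, h0, rfl⟩
      rintro r ⟨u, hu, -, -, rfl⟩
      exact rayleigh_nonneg hu
    rw [rayleigh_eq hv] at h1
    have h2 := (le_div_iff₀ hpos).1 (hlam.trans h1)
    linarith

lemma exists_dform_self_le {ω : Set (ℝ × ℝ)} {N l : ℕ}
    (hne : ∃ u, testFun ω u ∧ inAClass N l u ∧ u ≠ 0) {η : ℝ} (hη : 0 < η) :
    ∃ u, testFun ω u ∧ inAClass N l u ∧ u ≠ 0 ∧
      dform (symLambda1 ω N l) u u ≤ η * ∫ x, u x ^ 2 := by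
  obtain ⟨u₀, h1, h2, h3⟩ := hne
  obtain ⟨r, ⟨u, hu, huc, hu0, rfl⟩, hr⟩ := Real.lt_sInf_add_pos
    (s := {r | ∃ u, testFun ω u ∧ inAClass N l u ∧ u ≠ 0 ∧ r = rayleigh ω u})
    ⟨_, u₀, h1, h2, h3, rfl⟩ hη
  refine ⟨u, hu, huc, hu0, ?_⟩
  have hpos := hu.isTest.integral_sq_pos hu0
  rw [rayleigh_eq hu, div_lt_iff₀ hpos] at hr
  rw [dform_self hu.isTest, symLambda1]
  linarith

section Antisymmetric
variable {N : ℕ} {u : ℝ × ℝ → ℝ}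

lemma cos_half {N : ℕ} (hN : 0 < N) (hNe : Even N) : Real.cos (2 * π * (N / 2 : ℕ) / N) = -1 := by
  obtain ⟨m, rfl⟩ := hNe
  have hm : (m : ℝ) ≠ 0 := by
    have : 0 < m := by omega
    positivity
  rw [show (m + m) / 2 = m by omega, show 2 * π * (m : ℝ) / ((m + m : ℕ) : ℝ) = π by
    push_cast; field_simp; ring, Real.cos_pi]

lemma inAClass.comp_rot_eq_neg (hN : 0 < N) (hNe : Even N) (h : inAClass N (N / 2) u)
    (x : ℝ × ℝ) : u (rot (2 * π / N) x) = -u x := by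
  have hN' : (N : ℝ) ≠ 0 := by positivity
  set A := 2 * π / N with hA
  have key : ∀ y, u (rot (-A) y) = -u y := fun y => by
    have hs : ∀ j : ℕ, u (rot (-(A * (j + 2))) y) = -u (rot (-(A * j)) y)
        - 2 * u (rot (-(A * (j + 1))) y) := fun j => by
      have := h (rot (-(A * j)) y)
      rw [cos_half hN hNe, ← hA, rot_rot, rot_rot,
        show -A + -(A * (j : ℝ)) = -(A * (j + 1)) by ring,
        show -(2 * A) + -(A * (j : ℝ)) = -(A * (j + 2)) by ring] at this
      linarith
    have hj : ∀ j : ℕ, u (rot (-(A * j)) y) = (-1) ^ j * (u y - j * (u y + u (rot (-A) y))) ∧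
        u (rot (-(A * (j + 1))) y) =
          (-1) ^ (j + 1) * (u y - (j + 1) * (u y + u (rot (-A) y))) := fun j => by
      induction j with
      | zero => simp [rot_zero']
      | succ j ih =>
        refine ⟨by push_cast; exact ih.2, ?_⟩
        have := hs j
        rw [ih.1, ih.2] at this
        push_cast
        rw [show (j : ℝ) + 1 + 1 = j + 2 by ring, this]
        ring
    have h2 := (hj N).1
    rw [hNe.neg_one_pow, show A * (N : ℝ) = 2 * π by rw [hA]; field_simp,
      show rot (-(2 * π)) y = y by simp [rot]] at h2
    have h3 : (N : ℝ) * (u y + u (rot (-A) y)) = 0 := by linarith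
    have := (mul_eq_zero.1 h3).resolve_left hN'
    linarith
  have := key (rot A x)
  rw [rot_rot, neg_add_cancel, rot_zero'] at this
  linarith

lemma inAClass_half_of_neg (hN : 0 < N) (hNe : Even N)
    (h : ∀ x, u (rot (-(2 * π / N)) x) = -u x) : inAClass N (N / 2) u := fun x => by
  rw [cos_half hN hNe, h, show -(2 * (2 * π / N)) = -(2 * π / N) + -(2 * π / N) by ring, ← rot_rot,
    h, h]
  ring

lemma comp_rot_even (h : ∀ x, u (rot (2 * π / N) x) = -u x) (j : ℤ) (x : ℝ × ℝ) :
    u (rot (2 * (2 * π / N) * j) x) = u x := by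
  have h2 : ∀ y, u (rot (2 * (2 * π / N)) y) = u y := fun y => by
    rw [two_mul, ← rot_rot, h, h, neg_neg]
  induction j using Int.induction_on with
  | zero => simp [rot_zero']
  | succ j ih =>
    rw [show 2 * (2 * π / N) * (((j : ℤ) + 1 : ℤ) : ℝ) = 2 * (2 * π / N) +
      2 * (2 * π / N) * ((j : ℤ) : ℝ) by push_cast; ring, ← rot_rot, h2, ih]
  | pred j ih =>
    rw [← ih, ← h2 (rot (2 * (2 * π / N) * ((-(j : ℤ) - 1 : ℤ) : ℝ)) x), rot_rot]
    push_cast; ring_nf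

lemma refl₁_polarPt (r θ : ℝ) : refl₁ (polarPt r θ) = polarPt r (-θ) := by
  simp [refl₁, polarPt]

lemma eq_zero_of_onLines_of_odd (h : ∀ x, u (rot (2 * π / N) x) = -u x)
    (hr : ∀ x, u (refl₁ x) = -u x) {x : ℝ × ℝ} (hx : OnLines N 0 x) : u x = 0 := by
  obtain ⟨r, j, rfl⟩ := hx
  have h1 := hr (polarPt r (0 + 2 * π * j / N))
  have h2 := comp_rot_even h (-j) (polarPt r (0 + 2 * π * j / N))
  rw [rot_polarPt] at h2
  rw [refl₁_polarPt] at h1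
  rw [show 0 + 2 * π * j / N + 2 * (2 * π / N) * ((-j : ℤ) : ℝ) = -(0 + 2 * π * j / N) by
    push_cast; ring] at h2
  linarith

lemma eq_zero_of_onLines_of_even (h : ∀ x, u (rot (2 * π / N) x) = -u x)
    (hr : ∀ x, u (refl₁ x) = u x) {x : ℝ × ℝ} (hx : OnLines N (-π / N) x) : u x = 0 := by
  obtain ⟨r, j, rfl⟩ := hx
  have h1 := hr (polarPt r (-π / N + 2 * π * j / N))
  have h2 := comp_rot_even h (-j) (polarPt r (-π / N + 2 * π * j / N))
  have h3 := h (rot (2 * (2 * π / N) * ((-j : ℤ) : ℝ)) (polarPt r (-π / N + 2 * π * j / N)))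
  rw [h2, rot_polarPt, rot_polarPt] at h3
  rw [refl₁_polarPt] at h1
  rw [show -π / N + 2 * π * j / N + 2 * (2 * π / N) * ((-j : ℤ) : ℝ) + 2 * π / N
    = -(-π / N + 2 * π * j / N) by push_cast; ring] at h3
  linarith

end Antisymmetric

/-- The harmonic polynomial `Re (x + iy)ᵐ` times a radial cut-off. -/
def cutHarmonic (m : ℕ) (R : ℝ) (x : ℝ × ℝ) : ℝ :=
  (((x.1 : ℂ) + x.2 * Complex.I) ^ m).re * Real.smoothTransition (R ^ 2 - nsq x)

lemma contDiff_cutHarmonic (m : ℕ) (R : ℝ) {n : ℕ∞} : ContDiff ℝ n (cutHarmonic m R) := by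
  have h1 : ContDiff ℝ n fun x : ℝ × ℝ => ((x.1 : ℂ) + x.2 * Complex.I) ^ m :=
    ((Complex.ofRealCLM.contDiff.comp contDiff_fst).add
      ((Complex.ofRealCLM.contDiff.comp contDiff_snd).mul contDiff_const)).pow m
  have h2 : ContDiff ℝ n nsq := by unfold nsq; fun_prop
  exact (Complex.reCLM.contDiff.comp h1).mul
    (Real.smoothTransition.contDiff.comp (contDiff_const.sub h2))

lemma exists_inAClass_half {N : ℕ} (hN : 0 < N) (hNe : Even N) {R : ℝ} (hR : 0 < R)
    {ω : Set (ℝ × ℝ)} (hω : ∀ x, nsq x ≤ R ^ 2 → x ∈ ω) :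
    ∃ u, testFun ω u ∧ inAClass N (N / 2) u ∧ u ≠ 0 := by
  have hz : ∀ x : ℝ × ℝ, ¬ nsq x ≤ R ^ 2 → cutHarmonic (N / 2) R x = 0 := fun x hx => by
    rw [cutHarmonic, Real.smoothTransition.zero_of_nonpos (by linarith), mul_zero]
  have hc : IsCompact {x : ℝ × ℝ | nsq x ≤ R ^ 2} := by
    refine (isCompact_Icc (a := ((-R, -R) : ℝ × ℝ)) (b := (R, R))).of_isClosed_subset
      (isClosed_le continuous_nsq continuous_const) fun x hx => ?_
    have hx' : x.1 ^ 2 + x.2 ^ 2 ≤ R ^ 2 := hx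
    have h1 := abs_le.1 (abs_le_of_sq_le_sq (a := x.1) (b := R) (by nlinarith [sq_nonneg x.2]) hR.le)
    have h2 := abs_le.1 (abs_le_of_sq_le_sq (a := x.2) (b := R) (by nlinarith [sq_nonneg x.1]) hR.le)
    exact ⟨⟨h1.1, h2.1⟩, ⟨h1.2, h2.2⟩⟩
  have ht : IsTest (cutHarmonic (N / 2) R) :=
    ⟨contDiff_cutHarmonic _ _, HasCompactSupport.intro hc fun x hx => hz x hx⟩
  refine ⟨cutHarmonic (N / 2) R, testFun.of_closed ht
    (isClosed_le continuous_nsq continuous_const) hω fun x hx => hz x hx, ?_, ?_⟩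
  · refine inAClass_half_of_neg hN hNe fun x => ?_
    simp only [cutHarmonic, nsq_rot]
    have h1 : ((rot (-(2 * π / N)) x).1 : ℂ) + (rot (-(2 * π / N)) x).2 * Complex.I =
        Complex.exp ((-(2 * π / N) : ℝ) * Complex.I) * ((x.1 : ℂ) + x.2 * Complex.I) := by
      rw [Complex.exp_mul_I, ← Complex.ofReal_cos, ← Complex.ofReal_sin]
      simp only [rot]
      push_cast
      linear_combination (-(Complex.sin (-(2 * π / N))) * x.2) * Complex.I_sq
    have h2 : Complex.exp ((-(2 * π / N) : ℝ) * Complex.I) ^ (N / 2) = -1 := by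
      rw [← Complex.exp_nat_mul]
      obtain ⟨m, rfl⟩ := hNe
      have hm : (m : ℂ) ≠ 0 := by
        have : 0 < m := by omega
        exact_mod_cast this.ne'
      rw [show (m + m) / 2 = m by omega, show (m : ℂ) * ((-(2 * π / ((m + m : ℕ) : ℝ)) : ℝ) *
        Complex.I) = -(π * Complex.I) by push_cast; field_simp; ring, Complex.exp_neg,
        Complex.exp_pi_mul_I]
      norm_num
    rw [h1, mul_pow, h2]
    simp
  · intro h0
    have := congrFun h0 (R / 2, 0)
    simp only [cutHarmonic, nsq, Pi.zero_apply] at this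
    have h3 : 0 < Real.smoothTransition (R ^ 2 - ((R / 2) ^ 2 + 0 ^ 2)) :=
      Real.smoothTransition.pos_of_pos (by nlinarith)
    rw [mul_eq_zero, or_iff_left h3.ne'] at this
    rw [show (((R / 2 : ℝ) : ℂ) + ((0 : ℝ) : ℂ) * Complex.I) ^ (N / 2) =
      (((R / 2) ^ (N / 2) : ℝ) : ℂ) by push_cast; ring, Complex.ofReal_re] at this
    have : 0 < (R / 2) ^ (N / 2) := by positivity
    linarith

/-- A smooth version of the positive part of `t - 1`. -/
def softPos (t : ℝ) : ℝ := ∫ s in (0 : ℝ)..t, Real.smoothTransition (s - 1)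

lemma continuous_smoothTransition_sub_one : Continuous fun s : ℝ => Real.smoothTransition (s - 1) :=
  Real.smoothTransition.continuous.comp (continuous_id.sub continuous_const)

lemma hasDerivAt_softPos (t : ℝ) : HasDerivAt softPos (Real.smoothTransition (t - 1)) t :=
  continuous_smoothTransition_sub_one.integral_hasStrictDerivAt 0 t |>.hasDerivAt

lemma contDiff_softPos : ContDiff ℝ (⊤ : ℕ∞) softPos := by
  rw [contDiff_infty_iff_deriv]
  refine ⟨fun t => (hasDerivAt_softPos t).differentiableAt, ?_⟩
  rw [show deriv softPos = fun t => Real.smoothTransition (t - 1) from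
    funext fun t => (hasDerivAt_softPos t).deriv]
  exact Real.smoothTransition.contDiff.comp (contDiff_id.sub contDiff_const)

lemma softPos_eq_zero {t : ℝ} (ht : t ≤ 1) : softPos t = 0 := by
  refine intervalIntegral.integral_zero_ae (Filter.Eventually.of_forall fun s hs => ?_)
  refine Real.smoothTransition.zero_of_nonpos ?_
  have h := hs.2
  have : max 0 t ≤ 1 := max_le zero_le_one ht
  linarith

lemma softPos_nonneg (t : ℝ) : 0 ≤ softPos t := by
  rcases le_total t 1 with h | h
  · rw [softPos_eq_zero h]
  · exact intervalIntegral.integral_nonneg (by linarith) fun s _ => Real.smoothTransition.nonneg _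

lemma le_softPos (t : ℝ) : t - 2 ≤ softPos t := by
  rcases le_total t 2 with h | h
  · exact (by linarith : t - 2 ≤ 0).trans (softPos_nonneg t)
  · have hi : ∀ a b : ℝ, IntervalIntegrable (fun s => Real.smoothTransition (s - 1)) volume a b :=
      fun a b => continuous_smoothTransition_sub_one.intervalIntegrable a b
    have h1 : softPos t = softPos 2 + ∫ s in (2 : ℝ)..t, Real.smoothTransition (s - 1) :=
      (intervalIntegral.integral_add_adjacent_intervals (hi 0 2) (hi 2 t)).symm
    have h2 : ∫ s in (2 : ℝ)..t, Real.smoothTransition (s - 1) = ∫ s in (2 : ℝ)..t, (1 : ℝ) := by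
      refine intervalIntegral.integral_congr fun s hs => ?_
      rw [uIcc_of_le h] at hs
      exact Real.smoothTransition.one_of_one_le (by linarith [hs.1])
    rw [h1, h2]
    simp [softPos_nonneg]

/-- An even, smooth substitute for `|t|`, vanishing near the origin. -/
def softAbs (δ t : ℝ) : ℝ := δ * (softPos (t / δ) + softPos (-t / δ))

section
variable {δ : ℝ}

lemma softAbs_neg (δ t : ℝ) : softAbs δ (-t) = softAbs δ t := by
  rw [softAbs, softAbs, neg_neg, add_comm]

lemma softAbs_nonneg (hδ : 0 < δ) (t : ℝ) : 0 ≤ softAbs δ t :=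
  mul_nonneg hδ.le (add_nonneg (softPos_nonneg _) (softPos_nonneg _))

lemma softAbs_eq_zero (hδ : 0 < δ) {t : ℝ} (ht : |t| ≤ δ) : softAbs δ t = 0 := by
  have h := abs_le.1 ht
  rw [softAbs, softPos_eq_zero ((div_le_one hδ).2 h.2),
    softPos_eq_zero ((div_le_one hδ).2 (by linarith)), add_zero, mul_zero]

lemma le_softAbs (hδ : 0 < δ) (t : ℝ) : |t| - 2 * δ ≤ softAbs δ t := by
  have h : ∀ s : ℝ, s - 2 * δ ≤ δ * softPos (s / δ) := fun s => by
    have := mul_le_mul_of_nonneg_left (le_softPos (s / δ)) hδ.le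
    rwa [mul_sub, mul_div_cancel₀ _ hδ.ne', mul_comm δ 2] at this
  have h1 := mul_nonneg hδ.le (softPos_nonneg (t / δ))
  have h2 := mul_nonneg hδ.le (softPos_nonneg (-t / δ))
  have h3 := h t
  have h4 := h (-t)
  rw [softAbs, mul_add]
  rcases abs_cases t with ⟨e, _⟩ | ⟨e, _⟩ <;> rw [e] <;> linarith

lemma contDiff_softAbs (δ : ℝ) : ContDiff ℝ (⊤ : ℕ∞) (softAbs δ) :=
  contDiff_const.mul ((contDiff_softPos.comp (contDiff_id.div_const δ)).add
    (contDiff_softPos.comp (contDiff_neg.div_const δ)))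

lemma abs_deriv_softAbs_le (hδ : 0 < δ) (t : ℝ) : |deriv (softAbs δ) t| ≤ 1 := by
  have h1 : HasDerivAt (fun t => softPos (t / δ)) (Real.smoothTransition (t / δ - 1) * (1 / δ)) t :=
    (hasDerivAt_softPos _).comp t ((hasDerivAt_id t).div_const δ)
  have h2 : HasDerivAt (fun t => softPos (-t / δ)) (Real.smoothTransition (-t / δ - 1) * (-1 / δ)) t :=
    (hasDerivAt_softPos _).comp t ((hasDerivAt_neg t).div_const δ)
  have h3 : deriv (softAbs δ) t =
      Real.smoothTransition (t / δ - 1) - Real.smoothTransition (-t / δ - 1) := by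
    have h12 : HasDerivAt (softAbs δ) _ t := (h1.add h2).const_mul δ
    rw [h12.deriv]
    field_simp; ring
  rw [h3, abs_le]
  have a1 := Real.smoothTransition.nonneg (t / δ - 1)
  have a2 := Real.smoothTransition.nonneg (-t / δ - 1)
  have a3 := Real.smoothTransition.le_one (t / δ - 1)
  have a4 := Real.smoothTransition.le_one (-t / δ - 1)
  constructor <;> linarith

lemma sq_softAbs_ge (hδ : 0 < δ) (t : ℝ) : t ^ 2 - 4 * δ * |t| ≤ softAbs δ t ^ 2 := by
  have h1 := softAbs_nonneg hδ t
  have h2 := le_softAbs hδ t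
  have h3 := abs_nonneg t
  rw [← sq_abs t]
  rcases le_total |t| (2 * δ) with h | h
  · nlinarith
  · nlinarith

lemma isTest_softAbs_comp (hδ : 0 < δ) {u : ℝ × ℝ → ℝ} (hu : IsTest u) :
    IsTest (fun x => softAbs δ (u x)) :=
  ⟨(contDiff_softAbs δ).comp hu.1, hu.2.comp_left (g := softAbs δ)
    (softAbs_eq_zero hδ (by simpa using hδ.le))⟩

lemma gradSq_softAbs_comp_le (hδ : 0 < δ) {u : ℝ × ℝ → ℝ} (hu : IsTest u) (x : ℝ × ℝ) :
    gradSq (fun x => softAbs δ (u x)) x ≤ gradSq u x := by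
  have hd : HasDerivAt (softAbs δ) (deriv (softAbs δ) (u x)) (u x) :=
    ((contDiff_softAbs δ).differentiable (by simp) _).hasDerivAt
  have h := (hd.comp_hasFDerivAt x (hu.differentiable x).hasFDerivAt).fderiv
  have h' : fderiv ℝ (fun x => softAbs δ (u x)) x = deriv (softAbs δ) (u x) • fderiv ℝ u x := h
  have hb : deriv (softAbs δ) (u x) ^ 2 ≤ 1 := (sq_le_one_iff_abs_le_one _).2 (abs_deriv_softAbs_le hδ _)
  simp only [gradSq, h', smul_apply, smul_eq_mul, mul_pow]
  rw [← mul_add]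
  exact mul_le_of_le_one_left (by positivity) hb

end

/-- A nonnegative test function, invariant under rotation by `2π/N`, vanishing near the lines of
angles `a + 2πj/N`, with unit `L²` norm. -/
structure IsProfile (ω : Set (ℝ × ℝ)) (N : ℕ) (a : ℝ) (f : ℝ × ℝ → ℝ) : Prop where
  test : testFun ω f
  nonneg : ∀ x, 0 ≤ f x
  rot : ∀ x, f (rot (2 * π / N) x) = f x
  lines : ∀ x, OnLines N a x → f =ᶠ[nhds x] 0
  norm : ∫ x, f x ^ 2 = 1

lemma dform_const_mul_self {v : ℝ × ℝ → ℝ} (hv : IsTest v) (lam c : ℝ) :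
    dform lam (fun x => c * v x) (fun x => c * v x) = c ^ 2 * dform lam v v := by
  rw [dform, dform, ← integral_const_mul]
  congr 1; ext x
  rw [fderiv_const_mul (hv.differentiable x)]
  simp; ring

lemma exists_isProfile_of_antisymm {ω : Set (ℝ × ℝ)} {N : ℕ} {a lam η : ℝ} (hlam : 0 ≤ lam)
    (hη : 0 < η) {u : ℝ × ℝ → ℝ} (hu : testFun ω u) (h0 : u ≠ 0)
    (hrot : ∀ x, u (rot (2 * π / N) x) = -u x) (hlines : ∀ x, OnLines N a x → u x = 0)
    (hq : dform lam u u ≤ η / 4 * ∫ x, u x ^ 2) :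
    ∃ f, IsProfile ω N a f ∧ dform lam f f ≤ η := by
  have hut := hu.isTest
  set V := ∫ x, u x ^ 2 with hV
  have hVpos : 0 < V := hut.integral_sq_pos h0
  set I := ∫ x, |u x| with hI
  have hI0 : 0 ≤ I := integral_nonneg fun x => abs_nonneg _
  have hIi : Integrable fun x => |u x| :=
    (hut.continuous.integrable_of_hasCompactSupport hut.2).abs
  set c := min (V / 2) (η * V / 4) with hc
  have hcpos : 0 < c := lt_min (by positivity) (by positivity)
  set δ := c / (4 * I * (1 + lam) + 1) with hδ
  have hδpos : 0 < δ := by positivity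
  have hδc : 4 * δ * I * (1 + lam) ≤ c := by
    have : δ * (4 * I * (1 + lam) + 1) = c := div_mul_cancel₀ _ (by positivity)
    nlinarith
  have h4 : 0 ≤ 4 * δ * I := by positivity
  have hc1 : 4 * δ * I ≤ V / 2 := by
    have := min_le_left (V / 2) (η * V / 4)
    nlinarith
  have hc2 : lam * (4 * δ * I) ≤ η * V / 4 := by
    have := min_le_right (V / 2) (η * V / 4)
    nlinarith
  set g := fun x => softAbs δ (u x) with hg
  have hgt : IsTest g := isTest_softAbs_comp hδpos hut
  set G := ∫ x, g x ^ 2 with hG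
  have hGV : V - 4 * δ * I ≤ G := by
    rw [hV, hI, ← integral_const_mul, ← integral_sub hut.integrable_sq (hIi.const_mul _)]
    exact integral_mono (hut.integrable_sq.sub (hIi.const_mul _)) hgt.integrable_sq
      fun x => sq_softAbs_ge hδpos (u x)
  have hGpos : 0 < G := by linarith
  have hgrad : ∫ x, gradSq g x ≤ ∫ x, gradSq u x :=
    integral_mono hgt.integrable_gradSq hut.integrable_gradSq
      fun x => gradSq_softAbs_comp_le hδpos hut x
  have hqg : dform lam g g ≤ η * G := by
    rw [dform_self hgt]
    rw [dform_self hut] at hq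
    have := mul_le_mul_of_nonneg_left hGV hlam
    nlinarith
  have hsq : (√G)⁻¹ ^ 2 = G⁻¹ := by rw [inv_pow, Real.sq_sqrt hGpos.le]
  refine ⟨fun x => (√G)⁻¹ * g x, ⟨?_, ?_, ?_, ?_, ?_⟩, ?_⟩
  · refine testFun.of_closed (hgt.const_mul _) (isClosed_tsupport u) hu.2.2 fun x hx => ?_
    simp only [hg, image_eq_zero_of_notMem_tsupport hx]
    rw [softAbs_eq_zero hδpos (by simpa using hδpos.le), mul_zero]
  · exact fun x => mul_nonneg (by positivity) (softAbs_nonneg hδpos _)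
  · intro x
    simp only [hg, hrot, softAbs_neg]
  · intro x hx
    have : ∀ᶠ y in nhds x, |u y| < δ :=
      hut.continuous.abs.continuousAt.eventually (gt_mem_nhds (by simpa [hlines x hx]))
    filter_upwards [this] with y hy
    simp [hg, softAbs_eq_zero hδpos hy.le]
  · simp only [mul_pow, integral_const_mul, hsq]
    exact inv_mul_cancel₀ hGpos.ne'
  · rw [dform_const_mul_self hgt, hsq, inv_mul_le_iff₀ hGpos, mul_comm]
    exact hqg

lemma contDiff_refl₁ {n : WithTop ℕ∞} : ContDiff ℝ n refl₁ := by unfold refl₁; fun_prop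

lemma refl₁_refl₁ (x : ℝ × ℝ) : refl₁ (refl₁ x) = x := by simp [refl₁]

lemma isTest_comp_refl₁ {u : ℝ × ℝ → ℝ} (hu : IsTest u) : IsTest fun x => u (refl₁ x) := by
  refine ⟨hu.1.comp contDiff_refl₁, ?_⟩
  have hinj : Function.LeftInverse refl₁ refl₁ := refl₁_refl₁
  exact hu.2.comp_isClosedEmbedding (g := refl₁) (Homeomorph.isClosedEmbedding
    ⟨⟨refl₁, refl₁, hinj, hinj⟩, (contDiff_refl₁ (n := 0)).continuous,
      (contDiff_refl₁ (n := 0)).continuous⟩)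

lemma gradSq_comp_refl₁ {u : ℝ × ℝ → ℝ} (hu : IsTest u) (x : ℝ × ℝ) :
    gradSq (fun x => u (refl₁ x)) x = gradSq u (refl₁ x) := by
  have h1 : HasFDerivAt refl₁ ((ContinuousLinearMap.fst ℝ ℝ ℝ).prod
      (-(ContinuousLinearMap.snd ℝ ℝ ℝ))) x :=
    hasFDerivAt_fst.prodMk hasFDerivAt_snd.neg
  have h2 : fderiv ℝ (fun x => u (refl₁ x)) x = _ :=
    ((hu.differentiable (refl₁ x)).hasFDerivAt.comp x h1).fderiv
  simp only [gradSq, h2]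
  have : ((0 : ℝ), (-1 : ℝ)) = -(0, 1) := by simp
  change fderiv ℝ u (refl₁ x) (1, -0) ^ 2 + fderiv ℝ u (refl₁ x) (0, -1) ^ 2 = _
  rw [neg_zero, this, map_neg, neg_sq]

lemma exists_isProfile_of_half {ω : Set (ℝ × ℝ)} {N : ℕ} {lam η : ℝ} (hN : 0 < N) (hNe : Even N)
    (hω : ∀ x ∈ ω, refl₁ x ∈ ω) (hlam : 0 ≤ lam) (hη : 0 < η) {u : ℝ × ℝ → ℝ} (hu : testFun ω u)
    (hc : inAClass N (N / 2) u) (h0 : u ≠ 0) (hq : dform lam u u ≤ η / 4 * ∫ x, u x ^ 2) :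
    (∃ f, IsProfile ω N 0 f ∧ dform lam f f ≤ η) ∨
      ∃ f, IsProfile ω N (-π / N) f ∧ dform lam f f ≤ η := by
  have hut := hu.isTest
  set w := fun x => u (refl₁ x) with hw
  have hwt : IsTest w := isTest_comp_refl₁ hut
  have hwω : testFun ω w := by
    refine testFun.of_closed (S := refl₁ ⁻¹' tsupport u) hwt
      ((isClosed_tsupport u).preimage (contDiff_refl₁ (n := 0)).continuous) (fun x hx => ?_)
      fun x hx => image_eq_zero_of_notMem_tsupport (x := refl₁ x) hx
    rw [← refl₁_refl₁ x]
    exact hω _ (hu.2.2 hx)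
  have hqw : dform lam w w = dform lam u u := by
    rw [dform_self hwt, dform_self hut,
      show gradSq w = fun x => gradSq u (refl₁ x) from funext fun x => gradSq_comp_refl₁ hut x,
      integral_comp_refl₁ _ hut.continuous_gradSq,
      integral_comp_refl₁ (fun x => u x ^ 2) (hut.continuous.pow 2)]
  have hnw : ∫ x, w x ^ 2 = ∫ x, u x ^ 2 :=
    integral_comp_refl₁ (fun x => u x ^ 2) (hut.continuous.pow 2)
  have hrot := hc.comp_rot_eq_neg hN hNe
  have hrotw : ∀ x, w (rot (2 * π / N) x) = -w x := fun x => by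
    have h1 : refl₁ x = rot (2 * π / N) (refl₁ (rot (2 * π / N) x)) := by
      simp only [refl₁, rot]
      ext
      · simp only; linear_combination (-x.1) * Real.sin_sq_add_cos_sq (2 * π / N)
      · simp only; linear_combination x.2 * Real.sin_sq_add_cos_sq (2 * π / N)
    have h2 := hrot (refl₁ (rot (2 * π / N) x))
    rw [← h1] at h2
    simp only [hw]
    linarith
  have hv : ∀ t : ℝ, testFun ω (fun x => u x + t * w x) := fun t => hu.add_const_mul hwω t
  have hvrot : ∀ t x, u (rot (2 * π / N) x) + t * w (rot (2 * π / N) x) = -(u x + t * w x) :=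
    fun t x => by rw [hrot, hrotw]; ring
  have hev : ∀ x, u (refl₁ x) + 1 * w (refl₁ x) = u x + 1 * w x := fun x => by
    simp only [hw, refl₁_refl₁]; ring
  have hod : ∀ x, u (refl₁ x) + (-1) * w (refl₁ x) = -(u x + (-1) * w x) := fun x => by
    simp only [hw, refl₁_refl₁]; ring
  have e1 := dform_add_const_mul_self (lam := lam) hut hwt 1
  have e2 := dform_add_const_mul_self (lam := lam) hut hwt (-1)
  have e3 : (∫ x, (u x + 1 * w x) ^ 2) + ∫ x, (u x + (-1) * w x) ^ 2 = 4 * ∫ x, u x ^ 2 := by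
    have : (∫ x, (2 * u x ^ 2 + 2 * w x ^ 2)) = 4 * ∫ x, u x ^ 2 := by
      rw [integral_add (hut.integrable_sq.const_mul 2) (hwt.integrable_sq.const_mul 2),
        integral_const_mul, integral_const_mul, hnw]; ring
    rw [← this, ← integral_add (hv 1).isTest.integrable_sq (hv (-1)).isTest.integrable_sq]
    congr 1; ext x; ring
  rw [hqw] at e1 e2
  have even_case : (fun x => u x + 1 * w x) ≠ 0 →
      dform lam (fun x => u x + 1 * w x) (fun x => u x + 1 * w x) ≤
        η / 4 * ∫ x, (u x + 1 * w x) ^ 2 → ∃ f, IsProfile ω N (-π / N) f ∧ dform lam f f ≤ η :=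
    fun hn hl => exists_isProfile_of_antisymm hlam hη (hv 1) hn (hvrot 1)
      (fun x hx => eq_zero_of_onLines_of_even (u := fun x => u x + 1 * w x) (hvrot 1) hev hx) hl
  have odd_case : (fun x => u x + (-1) * w x) ≠ 0 →
      dform lam (fun x => u x + (-1) * w x) (fun x => u x + (-1) * w x) ≤
        η / 4 * ∫ x, (u x + (-1) * w x) ^ 2 → ∃ f, IsProfile ω N 0 f ∧ dform lam f f ≤ η :=
    fun hn hl => exists_isProfile_of_antisymm hlam hη (hv (-1)) hn (hvrot (-1))
      (fun x hx => eq_zero_of_onLines_of_odd (u := fun x => u x + (-1) * w x) (hvrot (-1)) hod hx) hl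
  have hz : dform lam (fun _ => (0 : ℝ)) (fun _ => (0 : ℝ)) = 0 := by simp [dform]
  by_cases hp : (fun x => u x + 1 * w x) = 0
  · have hp' : ∀ x, u x + 1 * w x = 0 := fun x => congrFun hp x
    have hn : (fun x => u x + (-1) * w x) = fun x => 2 * u x := by
      ext x; linarith [hp' x]
    refine Or.inl (odd_case (fun h => h0 ?_) ?_)
    · ext x
      have := congrFun (hn.symm.trans h) x
      simpa using this
    · simp only [hp', hz] at e1
      simp only [hp'] at e3
      simp only [ne_eq, OfNat.ofNat_ne_zero, not_false_eq_true, zero_pow, integral_zero, zero_add]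
        at e3
      rw [e3]; linarith
  · by_cases hm : (fun x => u x + (-1) * w x) = 0
    · have hm' : ∀ x, u x + (-1) * w x = 0 := fun x => congrFun hm x
      refine Or.inr (even_case hp ?_)
      simp only [hm', hz] at e2
      simp only [hm'] at e3
      simp only [ne_eq, OfNat.ofNat_ne_zero, not_false_eq_true, zero_pow, integral_zero, add_zero]
        at e3
      rw [e3]; linarith
    · by_contra hcon
      rw [not_or] at hcon
      have a1 := not_le.1 fun h => hcon.2 (even_case hp h)
      have a2 := not_le.1 fun h => hcon.1 (odd_case hm h)
      have : η / 4 * (∫ x, (u x + 1 * w x) ^ 2) + η / 4 * (∫ x, (u x + (-1) * w x) ^ 2) =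
        η / 4 * (4 * ∫ x, u x ^ 2) := by rw [← mul_add, e3]
      linarith

/-- Along one of the two families of lines, profiles almost realize the lowest eigenvalue in the
class `A_{N/2}`. -/
lemma exists_seq_isProfile {ω : Set (ℝ × ℝ)} {N : ℕ} (hN : 0 < N) (hNe : Even N)
    (hω : ∀ x ∈ ω, refl₁ x ∈ ω) (hne : ∃ u, testFun ω u ∧ inAClass N (N / 2) u ∧ u ≠ 0) :
    ∃ a : ℝ, (a = 0 ∨ a = -π / N) ∧ ∃ f : ℕ → ℝ × ℝ → ℝ, ∀ n, IsProfile ω N a (f n) ∧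
      dform (symLambda1 ω N (N / 2)) (f n) (f n) ≤ 1 / ((n : ℝ) + 1) := by
  set lam := symLambda1 ω N (N / 2) with hlam
  have key : ∀ η : ℝ, 0 < η → (∃ f, IsProfile ω N 0 f ∧ dform lam f f ≤ η) ∨
      ∃ f, IsProfile ω N (-π / N) f ∧ dform lam f f ≤ η := fun η hη => by
    obtain ⟨u, h1, h2, h3, h4⟩ := exists_dform_self_le hne (by positivity : 0 < η / 4)
    exact exists_isProfile_of_half hN hNe hω (symLambda1_nonneg _ _ _) hη h1 h2 h3 h4
  by_cases h : ∀ η : ℝ, 0 < η → ∃ f, IsProfile ω N 0 f ∧ dform lam f f ≤ η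
  · choose f hf using fun n : ℕ => h (1 / ((n : ℝ) + 1)) (by positivity)
    exact ⟨0, Or.inl rfl, f, hf⟩
  · push Not at h
    obtain ⟨η₀, hη₀, hno⟩ := h
    have h' : ∀ η : ℝ, 0 < η → ∃ f, IsProfile ω N (-π / N) f ∧ dform lam f f ≤ η := fun η hη => by
      rcases key (min η η₀) (lt_min hη hη₀) with ⟨f, hf, hl⟩ | ⟨f, hf, hl⟩
      · exact absurd (hl.trans (min_le_right _ _)) (not_le.2 (hno f hf))
      · exact ⟨f, hf, hl.trans (min_le_left _ _)⟩
    choose f hf using fun n : ℕ => h' (1 / ((n : ℝ) + 1)) (by positivity)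
    exact ⟨-π / N, Or.inr rfl, f, hf⟩

/-- The open half-plane of points with polar angle in `(a, a + π)`. -/
def halfPlane (a : ℝ) : Set (ℝ × ℝ) := {x | 0 < Real.cos a * x.2 - Real.sin a * x.1}

lemma isOpen_halfPlane (a : ℝ) : IsOpen (halfPlane a) :=
  isOpen_lt continuous_const (by fun_prop)

lemma polarPt_mem_halfPlane {a r θ : ℝ} (hr : 0 < r) (hθ : θ ∈ Ioo a (a + π)) :
    polarPt r θ ∈ halfPlane a := by
  have h : 0 < Real.sin (θ - a) :=
    Real.sin_pos_of_pos_of_lt_pi (by linarith [hθ.1]) (by linarith [hθ.2])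
  rw [Real.sin_sub] at h
  have : Real.cos a * (polarPt r θ).2 - Real.sin a * (polarPt r θ).1 =
      r * (Real.sin θ * Real.cos a - Real.cos θ * Real.sin a) := by simp only [polarPt]; ring
  rw [halfPlane, mem_ofPred_eq, this]
  exact mul_pos hr h

lemma exists_polarPt_mem_Ico {x : ℝ × ℝ} (hx : x ≠ 0) (a : ℝ) :
    ∃ r θ, 0 < r ∧ θ ∈ Ico a (a + 2 * π) ∧ x = polarPt r θ := by
  obtain ⟨r, θ, hr, rfl⟩ := exists_polarPt_of_ne_zero hx
  refine ⟨r, toIcoMod Real.two_pi_pos a θ, hr, toIcoMod_mem_Ico _ _ _, ?_⟩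
  rw [← polarPt_add_two_pi_mul r (toIcoMod Real.two_pi_pos a θ) (toIcoDiv Real.two_pi_pos a θ)]
  congr 1
  have := toIcoMod_add_toIcoDiv_zsmul Real.two_pi_pos a θ
  rw [zsmul_eq_mul] at this
  linarith

lemma exists_polarPt_of_mem_halfPlane {a : ℝ} {x : ℝ × ℝ} (hx : x ∈ halfPlane a) :
    ∃ r θ, 0 < r ∧ θ ∈ Ioo a (a + π) ∧ x = polarPt r θ := by
  obtain ⟨r, θ, hr, hθ, rfl⟩ := exists_polarPt_mem_Ico (x := x)
    (fun h => by simp [halfPlane, h] at hx) a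
  refine ⟨r, θ, hr, ?_, rfl⟩
  have h1 : Real.cos a * (polarPt r θ).2 - Real.sin a * (polarPt r θ).1 =
      r * Real.sin (θ - a) := by simp only [polarPt, Real.sin_sub]; ring
  rw [halfPlane, mem_ofPred_eq, h1] at hx
  have h2 : 0 < Real.sin (θ - a) := pos_of_mul_pos_right hx hr.le
  constructor
  · refine lt_of_le_of_ne hθ.1 fun h => ?_
    simp [h] at h2
  · by_contra hn
    have : Real.sin (θ - a - 2 * π) ≤ 0 :=
      Real.sin_nonpos_of_nonpos_of_neg_pi_le (by linarith [hθ.2]) (by linarith)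
    rw [Real.sin_sub_two_pi] at this
    linarith

section
variable {R₁ R₂ : ℝ} {N : ℕ} {ε : ℝ}

lemma isPreconnected_halfPlane_inter (hR₁ : 0 < R₁) (hR₁₂ : R₁ < R₂) (hN : 0 < N) (hε : 0 < ε)
    {a : ℝ} (k : ℤ) (h1 : a ≤ 2 * π * k / N) (h2 : 2 * π * k / N + ε ≤ a + π) :
    IsPreconnected (halfPlane a ∩ crackedDomain R₁ R₂ N ε) := by
  have hmem := fun x => mem_crackedDomain (x := x) (ε := ε) hR₁ hR₁₂ hN
  set φ := 2 * π * k / N with hφ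
  set A : Set (ℝ × ℝ) := Ioo 0 R₁ ×ˢ Ioo a (a + π)
  set B : Set (ℝ × ℝ) := Ioo R₁ R₂ ×ˢ Ioo a (a + π)
  set C : Set (ℝ × ℝ) := Ioo 0 R₂ ×ˢ Ioo φ (φ + ε)
  have hJ : ∀ θ ∈ Ioo φ (φ + ε), θ ∈ Ioo a (a + π) := fun θ hθ =>
    ⟨by linarith [hθ.1], by linarith [hθ.2]⟩
  have hmid : φ + ε / 2 ∈ Ioo φ (φ + ε) := ⟨by linarith, by linarith⟩
  have hpre : IsPreconnected ((A ∪ C) ∪ B) := by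
    refine IsPreconnected.union ((R₁ + R₂) / 2, φ + ε / 2)
      (Or.inr ⟨⟨by linarith, by linarith⟩, hmid⟩) ⟨⟨by linarith, by linarith⟩, hJ _ hmid⟩ ?_
      (isPreconnected_Ioo.prod isPreconnected_Ioo)
    exact IsPreconnected.union (R₁ / 2, φ + ε / 2) ⟨⟨by linarith, by linarith⟩, hJ _ hmid⟩
      ⟨⟨by linarith, by linarith⟩, hmid⟩ (isPreconnected_Ioo.prod isPreconnected_Ioo)
      (isPreconnected_Ioo.prod isPreconnected_Ioo)
  refine (hpre.image _ continuous_polarPt.continuousOn).subset_closure ?_ ?_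
  · have hsq : ∀ r : ℝ, 0 < r → r < R₂ → r ^ 2 < R₂ ^ 2 := fun r h0 h => by nlinarith
    have hne : ∀ r : ℝ, 0 < r → r ≠ R₁ → r ^ 2 ≠ R₁ ^ 2 := fun r h0 h h' =>
      h ((pow_left_inj₀ h0.le hR₁.le two_ne_zero).1 h')
    rintro _ ⟨⟨r, θ⟩, (⟨hr, hθ⟩ | ⟨hr, hθ⟩) | ⟨hr, hθ⟩, rfl⟩
    · have hr' : 0 < r ∧ r < R₁ := hr
      refine ⟨polarPt_mem_halfPlane hr'.1 hθ, (hmem _).2 ?_⟩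
      rw [nsq_polarPt]
      exact ⟨hsq _ hr'.1 (hr'.2.trans hR₁₂), Or.inl (hne _ hr'.1 hr'.2.ne)⟩
    · have hr' : 0 < r ∧ r < R₂ := hr
      have hθ' : θ ∈ Ioo φ (φ + ε) := hθ
      refine ⟨polarPt_mem_halfPlane hr'.1 (hJ _ hθ), (hmem _).2 ?_⟩
      rw [nsq_polarPt]
      refine ⟨hsq _ hr'.1 hr'.2, ?_⟩
      by_cases h : r = R₁
      · exact Or.inr ⟨k, θ, ⟨by linarith [hθ'.1], hθ'.2⟩, by rw [h]⟩
      · exact Or.inl (hne _ hr'.1 h)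
    · have hr' : R₁ < r ∧ r < R₂ := hr
      refine ⟨polarPt_mem_halfPlane (hR₁.trans hr'.1) hθ, (hmem _).2 ?_⟩
      rw [nsq_polarPt]
      exact ⟨hsq _ (hR₁.trans hr'.1) hr'.2, Or.inl (hne _ (hR₁.trans hr'.1) hr'.1.ne')⟩
  · rintro x ⟨hxH, hxΩ⟩
    obtain ⟨r, θ, hr, hθ, rfl⟩ := exists_polarPt_of_mem_halfPlane hxH
    have hr2 := ((hmem _).1 hxΩ).1
    rw [nsq_polarPt] at hr2
    have hr2' : r < R₂ := lt_of_pow_lt_pow_left₀ 2 (by linarith) hr2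
    rcases lt_trichotomy r R₁ with h | h | h
    · exact subset_closure ⟨(r, θ), Or.inl (Or.inl ⟨⟨hr, h⟩, hθ⟩), rfl⟩
    · refine map_mem_closure (f := fun t => polarPt t θ) (s := Ioo 0 R₁)
        (continuous_polarPt.comp (continuous_id.prodMk continuous_const)) ?_ fun t ht =>
          ⟨(t, θ), Or.inl (Or.inl ⟨ht, hθ⟩), rfl⟩
      rw [closure_Ioo hR₁.ne]
      exact ⟨hr.le, h.le⟩
    · exact subset_closure ⟨(r, θ), Or.inr ⟨⟨h, hr2'⟩, hθ⟩, rfl⟩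

end

lemma secCoef_nonneg {N : ℕ} (hN : 0 < N) {a : ℝ} {x : ℝ × ℝ} (hx : x ∈ halfPlane a) :
    0 ≤ secCoef N a 0 x := by
  obtain ⟨r, θ, hr, hθ, rfl⟩ := exists_polarPt_of_mem_halfPlane hx
  have hN' : (0 : ℝ) < N := by exact_mod_cast hN
  have hpi := Real.pi_pos
  rw [secCoef_polarPt hN _ _ hr, add_zero]
  set m := ⌊(θ - a) * N / (2 * π)⌋ with hm
  have h0 : 0 ≤ m := Int.floor_nonneg.2 (by have := hθ.1; have : 0 ≤ θ - a := by linarith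
                                            positivity)
  have h1 : (m : ℝ) ≤ (θ - a) * N / (2 * π) := Int.floor_le _
  have h0' : (0 : ℝ) ≤ m := by exact_mod_cast h0
  refine Real.sin_nonneg_of_nonneg_of_le_pi (by positivity) ?_
  calc 2 * π / N * (m : ℝ) ≤ 2 * π / N * ((θ - a) * N / (2 * π)) := by gcongr
    _ = θ - a := by field_simp
    _ ≤ π := by linarith [hθ.2]

lemma secCoef_polarPt_eq {N : ℕ} (hN : 0 < N) (a : ℝ) {r θ : ℝ} (hr : 0 < r) (j : ℤ)
    (hθ : θ ∈ Ico (a + 2 * π / N * j) (a + 2 * π / N * (j + 1))) :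
    secCoef N a 0 (polarPt r θ) = Real.sin (2 * π / N * j) := by
  have hN' : (0 : ℝ) < N := by exact_mod_cast hN
  have hpi := Real.pi_pos
  have : ⌊(θ - a) * N / (2 * π)⌋ = j := by
    rw [Int.floor_eq_iff]
    have h1 := hθ.1
    have h2 := hθ.2
    constructor
    · rw [le_div_iff₀ (by positivity)]
      have : 2 * π / N * j * N ≤ (θ - a) * N := by gcongr; linarith
      rw [show 2 * π / N * j * N = j * (2 * π) by field_simp] at this
      exact this
    · rw [div_lt_iff₀ (by positivity)]
      have : (θ - a) * N < 2 * π / N * (j + 1) * N := by gcongr; linarith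
      rw [show 2 * π / N * (j + 1) * N = (j + 1) * (2 * π) by field_simp] at this
      exact this
  rw [secCoef_polarPt hN _ _ hr, this, add_zero]

lemma IsProfile.shift {ω : Set (ℝ × ℝ)} {N : ℕ} {a : ℝ} {f : ℝ × ℝ → ℝ} (h : IsProfile ω N a f)
    (k : ℤ) : IsProfile ω N (a + 2 * π * k / N) f := by
  refine ⟨h.test, h.nonneg, h.rot, ?_, h.norm⟩
  rintro x ⟨r, j, rfl⟩
  exact h.lines _ ⟨r, k + j, by congr 1; push_cast; ring⟩

section Propagation
open Filter Topology

variable {F : ℕ → ℝ × ℝ → ℝ} {W : Set (ℝ × ℝ)}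

lemma tendsto_setIntegral_mono (hF : ∀ n, Integrable (F n)) (hpos : ∀ n, ∀ x ∈ W, 0 ≤ F n x)
    {V V' : Set (ℝ × ℝ)} (hV : IsOpen V) (hV' : IsOpen V') (hVV : V' ⊆ V) (hVW : V ⊆ W)
    (h : Tendsto (fun n => ∫ x in V, F n x) atTop (𝓝 0)) :
    Tendsto (fun n => ∫ x in V', F n x) atTop (𝓝 0) := by
  refine squeeze_zero (fun n => ?_) (fun n => ?_) h
  · exact setIntegral_nonneg hV'.measurableSet fun x hx => hpos n x (hVW (hVV hx))
  · refine setIntegral_mono_set (hF n).integrableOn ?_ hVV.eventuallyLE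
    filter_upwards [ae_restrict_mem hV.measurableSet] with x hx using hpos n x (hVW hx)

lemma isOpen_nsq_sub_lt (p : ℝ × ℝ) (s : ℝ) : IsOpen {x : ℝ × ℝ | nsq (x - p) < s} :=
  isOpen_lt (continuous_nsq.comp (continuous_id.sub continuous_const)) continuous_const

lemma nsq_sub_le_subset_closedBall (p : ℝ × ℝ) {R : ℝ} (hR : 0 ≤ R) :
    {x : ℝ × ℝ | nsq (x - p) ≤ R ^ 2} ⊆ Metric.closedBall p R := by
  intro x hx
  have hx' : (x.1 - p.1) ^ 2 + (x.2 - p.2) ^ 2 ≤ R ^ 2 := hx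
  rw [Metric.mem_closedBall, Prod.dist_eq, max_le_iff, Real.dist_eq, Real.dist_eq]
  exact ⟨abs_le_of_sq_le_sq (by nlinarith [sq_nonneg (x.2 - p.2)]) hR,
    abs_le_of_sq_le_sq (by nlinarith [sq_nonneg (x.1 - p.1)]) hR⟩

lemma nsq_sub_le_two_mul_dist_sq (x p : ℝ × ℝ) : nsq (x - p) ≤ 2 * dist x p ^ 2 := by
  have h1 : |x.1 - p.1| ≤ dist x p := by rw [Prod.dist_eq, Real.dist_eq]; exact le_max_left _ _
  have h2 : |x.2 - p.2| ≤ dist x p := by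
    rw [Prod.dist_eq, Real.dist_eq, Real.dist_eq]; exact le_max_right _ _
  have h3 := sq_le_sq' (by linarith [neg_abs_le (x.1 - p.1), abs_nonneg (x.1 - p.1)])
    ((le_abs_self _).trans h1)
  have h4 := sq_le_sq' (by linarith [neg_abs_le (x.2 - p.2), abs_nonneg (x.2 - p.2)])
    ((le_abs_self _).trans h2)
  change (x.1 - p.1) ^ 2 + (x.2 - p.2) ^ 2 ≤ _
  linarith

/-- Weak Harnack step: smallness of the mass propagates from a small disc to a larger one. -/
lemma tendsto_setIntegral_disc {lam : ℝ} (hlam : 0 ≤ lam) (hF : ∀ n, IsTest (F n))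
    (hpos : ∀ n, ∀ x ∈ W, 0 ≤ F n x) {p : ℝ × ℝ} {R ρ : ℝ} (hρ : 0 < ρ) (hρR : ρ < R / 2)
    (hW : {x | nsq (x - p) ≤ R ^ 2} ⊆ W)
    (hL : Tendsto (fun n => ∫ x, F n x * radLap lam (ρ ^ 2 / (8 * R ^ 4)) R (nsq (x - p))) atTop
      (𝓝 0))
    (h : Tendsto (fun n => ∫ x in {x | nsq (x - p) < ρ ^ 2}, F n x) atTop (𝓝 0)) :
    Tendsto (fun n => ∫ x in {x | nsq (x - p) < (R / 2) ^ 2}, F n x) atTop (𝓝 0) := by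
  have hR : 0 < R := by linarith
  set β := ρ ^ 2 / (8 * R ^ 4) with hβ
  have hβ0 : 0 < β := by positivity
  have hc := continuous_radLap lam β R
  obtain ⟨M, hM⟩ := (isCompact_Icc (a := (0 : ℝ)) (b := ρ ^ 2)).exists_bound_of_continuousOn
    hc.continuousOn
  have hM0 : 0 ≤ M := (norm_nonneg _).trans (hM 0 ⟨le_rfl, by positivity⟩)
  have hρR2 : ρ ^ 2 < (R / 2) ^ 2 := by nlinarith
  have hRR2 : (R / 2) ^ 2 < R ^ 2 := by nlinarith
  obtain ⟨s₀, hs₀, hmin⟩ := (isCompact_Icc (a := ρ ^ 2) (b := (R / 2) ^ 2)).exists_isMinOn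
    ⟨_, le_rfl, hρR2.le⟩ hc.continuousOn
  set κ := radLap lam β R s₀ with hκ
  have hκ0 : 0 < κ := radLap_pos hlam hρ (by linarith) hs₀.1 (hs₀.2.trans_lt hRR2)
  set E := {x : ℝ × ℝ | nsq (x - p) < (R / 2) ^ 2} with hE
  set D := {x : ℝ × ℝ | nsq (x - p) < ρ ^ 2} with hD
  have hEm : MeasurableSet E := (isOpen_nsq_sub_lt p _).measurableSet
  have hDm : MeasurableSet D := (isOpen_nsq_sub_lt p _).measurableSet
  have hint : ∀ n, Integrable (F n) := fun n =>
    (hF n).continuous.integrable_of_hasCompactSupport (hF n).2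
  have hptw : ∀ n x, κ * E.indicator (F n) x ≤
      F n x * radLap lam β R (nsq (x - p)) + (M + κ) * D.indicator (F n) x := fun n x => by
    rcases lt_or_ge (nsq (x - p)) (ρ ^ 2) with h1 | h1
    · have hxW : x ∈ W := hW (h1.le.trans (hρR2.trans hRR2).le)
      rw [indicator_of_mem (show x ∈ E from h1.trans hρR2), indicator_of_mem (show x ∈ D from h1)]
      have h2 := (abs_le.1 (hM (nsq (x - p)) ⟨nsq_nonneg _, h1.le⟩)).1
      have h3 := hpos n x hxW
      nlinarith
    · rw [indicator_of_notMem (show x ∉ D from not_lt.2 h1)]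
      rcases lt_or_ge (nsq (x - p)) ((R / 2) ^ 2) with h2 | h2
      · rw [indicator_of_mem (show x ∈ E from h2)]
        have hxW : x ∈ W := hW (h2.le.trans hRR2.le)
        have h3 : κ ≤ radLap lam β R (nsq (x - p)) := hmin ⟨h1, h2.le⟩
        nlinarith [hpos n x hxW]
      · rw [indicator_of_notMem (show x ∉ E from not_lt.2 h2)]
        rcases lt_or_ge (nsq (x - p)) (R ^ 2) with h3 | h3
        · have h4 := radLap_pos hlam hρ (by linarith) h1 h3
          have h5 := hpos n x (hW h3.le)
          simpa using mul_nonneg h5 h4.le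
        · simp [radLap_eq_zero hβ0 h3]
  have hI : ∀ n, κ * (∫ x in E, F n x) ≤
      (∫ x, F n x * radLap lam β R (nsq (x - p))) + (M + κ) * ∫ x in D, F n x := fun n => by
    have hi1 : Integrable fun x => F n x * radLap lam β R (nsq (x - p)) :=
      (hF n).integrable_mul (hc.comp (continuous_nsq.comp (continuous_id.sub continuous_const)))
    have hi2 := ((hint n).indicator hDm).const_mul (M + κ)
    rw [← integral_indicator hEm, ← integral_indicator hDm, ← integral_const_mul,
      ← integral_const_mul, ← integral_add hi1 hi2]
    exact integral_mono (((hint n).indicator hEm).const_mul κ) (hi1.add hi2) (hptw n)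
  have hlim : Tendsto (fun n => ((∫ x, F n x * radLap lam β R (nsq (x - p))) +
      (M + κ) * ∫ x in D, F n x) / κ) atTop (𝓝 0) := by
    simpa using (hL.add (h.const_mul (M + κ))).div_const κ
  refine squeeze_zero (fun n => ?_) (fun n => ?_) hlim
  · exact setIntegral_nonneg hEm fun x (hx : _ < _) => hpos n x (hW (hx.le.trans hRR2.le))
  · rw [le_div_iff₀ hκ0, mul_comm]
    exact hI n

/-- Smallness of the mass propagates over connected open sets. -/
lemma exists_nhds_tendsto_setIntegral {lam : ℝ} (hlam : 0 ≤ lam) (hF : ∀ n, IsTest (F n))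
    (hpos : ∀ n, ∀ x ∈ W, 0 ≤ F n x) (hWo : IsOpen W) (hWc : IsPreconnected W)
    (hL : ∀ p R β, 0 < R → 0 < β → {x | nsq (x - p) ≤ R ^ 2} ⊆ W →
      Tendsto (fun n => ∫ x, F n x * radLap lam β R (nsq (x - p))) atTop (𝓝 0))
    {V₀ : Set (ℝ × ℝ)} (hV₀ : IsOpen V₀) (hne : V₀.Nonempty) (hVW : V₀ ⊆ W)
    (h0 : Tendsto (fun n => ∫ x in V₀, F n x) atTop (𝓝 0)) {x : ℝ × ℝ} (hx : x ∈ W) :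
    ∃ V, IsOpen V ∧ x ∈ V ∧ V ⊆ W ∧ Tendsto (fun n => ∫ x in V, F n x) atTop (𝓝 0) := by
  set U := {x | ∃ V, IsOpen V ∧ x ∈ V ∧ V ⊆ W ∧
    Tendsto (fun n => ∫ x in V, F n x) atTop (𝓝 0)} with hU
  have hint : ∀ n, Integrable (F n) := fun n =>
    (hF n).continuous.integrable_of_hasCompactSupport (hF n).2
  have hUo : IsOpen U := by
    rw [isOpen_iff_mem_nhds]
    rintro x ⟨V, hVo, hxV, hV, ht⟩
    filter_upwards [hVo.mem_nhds hxV] with y hy using ⟨V, hVo, hy, hV, ht⟩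
  have hcl : closure U ∩ W ⊆ U := by
    rintro x ⟨hxc, hxW⟩
    obtain ⟨S, hS, hSW⟩ := Metric.nhds_basis_closedBall.mem_iff.1 (hWo.mem_nhds hxW)
    obtain ⟨y, ⟨V, hVo, hyV, hV, ht⟩, hxy⟩ := Metric.mem_closure_iff.1 hxc (S / 8) (by positivity)
    have hyS : {z | nsq (z - y) ≤ (S / 2) ^ 2} ⊆ W := by
      refine ((nsq_sub_le_subset_closedBall y (by positivity)).trans ?_).trans hSW
      refine Metric.closedBall_subset_closedBall' ?_
      rw [dist_comm]; linarith
    obtain ⟨r, hr, hrV⟩ := Metric.nhds_basis_closedBall.mem_iff.1 (hVo.mem_nhds hyV)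
    set ρ := min r (S / 8) with hρ
    have hρ0 : 0 < ρ := lt_min hr (by positivity)
    have hρS : ρ ≤ S / 8 := min_le_right _ _
    have hρV : {z | nsq (z - y) < ρ ^ 2} ⊆ V := fun z hz => by
      refine hrV (Metric.closedBall_subset_closedBall (min_le_left _ _)
        (nsq_sub_le_subset_closedBall y hρ0.le (show nsq (z - y) ≤ ρ ^ 2 from le_of_lt hz)))
    have hsmall := tendsto_setIntegral_mono hint hpos hVo (isOpen_nsq_sub_lt y _) hρV hV ht
    refine ⟨{z | nsq (z - y) < (S / 2 / 2) ^ 2}, isOpen_nsq_sub_lt y _, ?_, ?_,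
      tendsto_setIntegral_disc hlam hF hpos hρ0 (by linarith) hyS
        (hL _ _ _ (by positivity) (by positivity) hyS) hsmall⟩
    · have h1 := nsq_sub_le_two_mul_dist_sq x y
      have h2 : dist x y ^ 2 ≤ (S / 8) ^ 2 := by gcongr
      rw [mem_ofPred_eq]
      nlinarith
    · intro z hz
      have hz' : nsq (z - y) < (S / 2 / 2) ^ 2 := hz
      exact hyS (show nsq (z - y) ≤ (S / 2) ^ 2 by nlinarith)
  obtain ⟨x₀, hx₀⟩ := hne
  exact hWc.subset_of_closure_inter_subset hUo ⟨x₀, hVW hx₀, V₀, hV₀, hx₀, hVW, h0⟩ hcl hx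

lemma exists_open_tendsto_setIntegral_of_isCompact (hint : ∀ n, Integrable (F n))
    (hpos : ∀ n, ∀ x ∈ W, 0 ≤ F n x)
    (hloc : ∀ x ∈ W, ∃ V, IsOpen V ∧ x ∈ V ∧ V ⊆ W ∧
      Tendsto (fun n => ∫ x in V, F n x) atTop (𝓝 0)) {K : Set (ℝ × ℝ)} (hK : IsCompact K)
    (hKW : K ⊆ W) :
    ∃ V, IsOpen V ∧ K ⊆ V ∧ V ⊆ W ∧ Tendsto (fun n => ∫ x in V, F n x) atTop (𝓝 0) := by
  refine hK.induction_on (p := fun s => ∃ V, IsOpen V ∧ s ⊆ V ∧ V ⊆ W ∧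
    Tendsto (fun n => ∫ x in V, F n x) atTop (𝓝 0)) ?_ ?_ ?_ ?_
  · exact ⟨∅, isOpen_empty, subset_rfl, empty_subset _, by simp⟩
  · rintro s t hst ⟨V, h1, h2, h3⟩
    exact ⟨V, h1, hst.trans h2, h3⟩
  · rintro s t ⟨V, h1, h2, h3, h4⟩ ⟨V', h1', h2', h3', h4'⟩
    refine ⟨V ∪ V', h1.union h1', union_subset_union h2 h2', union_subset h3 h3', ?_⟩
    have hadd : Tendsto (fun n => (∫ x in V, F n x) + ∫ x in V', F n x) atTop (𝓝 0) := by
      simpa using h4.add h4'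
    refine squeeze_zero (fun n => ?_) (fun n => ?_) hadd
    · exact setIntegral_nonneg (h1.union h1').measurableSet
        fun x hx => hpos n x (union_subset h3 h3' hx)
    · rw [← union_sdiff_self, setIntegral_union disjoint_sdiff_right
        (h1'.measurableSet.diff h1.measurableSet) (hint n).integrableOn (hint n).integrableOn]
      refine add_le_add le_rfl
        (setIntegral_mono_set (hint n).integrableOn ?_ sdiff_subset.eventuallyLE)
      filter_upwards [ae_restrict_mem h1'.measurableSet] with x hx using hpos n x (h3' hx)
  · intro x hx
    obtain ⟨V, h1, h2, h3, h4⟩ := hloc x (hKW hx)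
    exact ⟨V, mem_nhdsWithin_of_mem_nhds (h1.mem_nhds h2), V, h1, subset_rfl, h3, h4⟩

/-- Local `L¹`-convergence to zero together with an `L⁴`-bound gives `L²`-convergence. -/
lemma tendsto_setIntegral_sq (hF : ∀ n, IsTest (F n)) (hpos : ∀ n, ∀ x ∈ W, 0 ≤ F n x)
    (hWo : IsOpen W) (hWfin : volume W ≠ ⊤) {C : ℝ} (hC : ∀ n, ∫ x, F n x ^ 4 ≤ C)
    (hloc : ∀ x ∈ W, ∃ V, IsOpen V ∧ x ∈ V ∧ V ⊆ W ∧
      Tendsto (fun n => ∫ x in V, F n x) atTop (𝓝 0)) :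
    Tendsto (fun n => ∫ x in W, F n x ^ 2) atTop (𝓝 0) := by
  have hint : ∀ n, Integrable (F n) := fun n =>
    (hF n).continuous.integrable_of_hasCompactSupport (hF n).2
  have hint4 : ∀ n, Integrable fun x => F n x ^ 4 := fun n =>
    ((hF n).continuous.pow 4).integrable_of_hasCompactSupport ((hF n).2.fun_pow (by norm_num))
  have hC0 : 0 ≤ C := (integral_nonneg fun x => by positivity).trans (hC 0)
  have hset4 : ∀ n S, ∫ x in S, F n x ^ 4 ≤ C := fun n S =>
    (setIntegral_le_integral (hint4 n) (Filter.Eventually.of_forall fun x => by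
      simp only [Pi.zero_apply]; positivity)).trans (hC n)
  rw [Metric.tendsto_atTop]
  intro e he
  set t := 8 * (C + 1) / e with ht
  have ht0 : 0 < t := by positivity
  have hCt : C / t ≤ e / 8 := by
    rw [ht, div_div_eq_mul_div, div_le_div_iff₀ (by positivity) (by positivity)]
    nlinarith
  clear_value t
  obtain ⟨K, hKW, hK, hKs⟩ := hWo.measurableSet.exists_isCompact_sdiff_lt hWfin
    (ε := ENNReal.ofReal (e / (8 * t))) (by simpa using by positivity)
  obtain ⟨V, hVo, hKV, hVW, hV⟩ := exists_open_tendsto_setIntegral_of_isCompact hint hpos hloc hK hKW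
  have hvol : volume.real (W \ V) ≤ e / (8 * t) := by
    refine ENNReal.toReal_le_of_le_ofReal (by positivity) ?_
    exact (measure_mono (sdiff_subset_sdiff_right hKV)).trans hKs.le
  have hfinV : volume (W \ V) ≠ ⊤ := ((measure_mono sdiff_subset).trans_lt hWfin.lt_top).ne
  have hconst : IntegrableOn (fun _ : ℝ × ℝ => t) (W \ V) := integrableOn_const hfinV
  set M := t + 1 with hM
  have hM1 : t ≤ M ^ 2 := by nlinarith
  have hCM : C / M ^ 2 ≤ e / 8 := (div_le_div_of_nonneg_left hC0 ht0 hM1).trans hCt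
  obtain ⟨n₀, hn₀⟩ := Metric.tendsto_atTop.1 hV (e / (8 * M)) (by positivity)
  refine ⟨n₀, fun n hn => ?_⟩
  have h1 : ∫ x in V, F n x ^ 2 ≤ M * (∫ x in V, F n x) + C / M ^ 2 := by
    have hb : ∫ x in V, F n x ^ 2 ≤ ∫ x in V, (M * F n x + F n x ^ 4 / M ^ 2) := by
      refine setIntegral_mono_on (hF n).integrable_sq.integrableOn
        (((hint n).const_mul M).add ((hint4 n).div_const _)).integrableOn hVo.measurableSet
        fun x hx => ?_
      have hx0 := hpos n x (hVW hx)
      rcases le_total (F n x) M with h | h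
      · have : 0 ≤ F n x ^ 4 / M ^ 2 := by positivity
        nlinarith
      · have : F n x ^ 2 ≤ F n x ^ 4 / M ^ 2 := by
          rw [le_div_iff₀ (by positivity)]
          have : M ^ 2 ≤ F n x ^ 2 := by gcongr
          nlinarith [sq_nonneg (F n x)]
        have : 0 ≤ M * F n x := by positivity
        linarith
    rw [integral_add ((hint n).const_mul M).integrableOn ((hint4 n).div_const _).integrableOn,
      integral_const_mul, integral_div] at hb
    have := div_le_div_of_nonneg_right (hset4 n V) (by positivity : 0 ≤ M ^ 2)
    linarith
  have h2 : ∫ x in W \ V, F n x ^ 2 ≤ t * volume.real (W \ V) + C / t := by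
    have hb : ∫ x in W \ V, F n x ^ 2 ≤ ∫ x in W \ V, (t + F n x ^ 4 / t) := by
      refine setIntegral_mono_on (hF n).integrable_sq.integrableOn
        (Integrable.add hconst ((hint4 n).div_const _).integrableOn)
        (hWo.measurableSet.diff hVo.measurableSet) fun x hx => ?_
      have h5 : t + F n x ^ 4 / t - F n x ^ 2 = ((F n x ^ 2 - t / 2) ^ 2 + 3 / 4 * t ^ 2) / t := by
        field_simp; ring
      have h6 : 0 ≤ ((F n x ^ 2 - t / 2) ^ 2 + 3 / 4 * t ^ 2) / t := by positivity
      linarith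
    rw [integral_add hconst ((hint4 n).div_const _).integrableOn,
      integral_div, setIntegral_const, smul_eq_mul] at hb
    have := div_le_div_of_nonneg_right (hset4 n (W \ V)) ht0.le
    linarith
  have h3 : ∫ x in W, F n x ^ 2 = (∫ x in V, F n x ^ 2) + ∫ x in W \ V, F n x ^ 2 := by
    rw [← setIntegral_union disjoint_sdiff_right (hWo.measurableSet.diff hVo.measurableSet)
      (hF n).integrable_sq.integrableOn (hF n).integrable_sq.integrableOn,
      union_sdiff_cancel hVW]
  have h4 := (abs_lt.1 (by simpa [Real.dist_eq] using hn₀ n hn)).2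
  have h5 : M * (∫ x in V, F n x) ≤ e / 8 := by
    have := mul_le_mul_of_nonneg_left h4.le (by positivity : 0 ≤ M)
    have hM0 : M ≠ 0 := by positivity
    rwa [show M * (e / (8 * M)) = e / 8 by clear_value M; field_simp] at this
  have h6 : t * volume.real (W \ V) ≤ e / 8 := by
    have := mul_le_mul_of_nonneg_left hvol ht0.le
    rwa [show t * (e / (8 * t)) = e / 8 by field_simp] at this
  rw [Real.dist_eq, sub_zero, abs_of_nonneg (integral_nonneg fun x => sq_nonneg _), h3]
  linarith

end Propagation

section Limits

open Filter Topology

variable {ω : Set (ℝ × ℝ)} {N : ℕ} {a lam : ℝ}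

lemma dform_secCoef_add {f : ℝ × ℝ → ℝ} (hN : 0 < N) (h : IsProfile ω N a f) :
    dform lam (fun y => secCoef N a 0 y * f y) (fun y => secCoef N a 0 y * f y) +
      dform lam (fun y => secCoef N a (π / 2) y * f y) (fun y => secCoef N a (π / 2) y * f y) =
      dform lam f f := by
  have hf := h.test.isTest
  have hv := fun φ => isTest_secCoef_mul hN hf h.lines φ
  have hg : (∫ x, gradSq f x) = (∫ x, gradSq (fun y => secCoef N a 0 y * f y) x) +
      ∫ x, gradSq (fun y => secCoef N a (π / 2) y * f y) x := by
    rw [← integral_add (hv _).integrable_gradSq (hv _).integrable_gradSq]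
    congr 1; ext x
    rw [gradSq_secCoef_mul hN hf h.lines, gradSq_secCoef_mul hN hf h.lines]
    linear_combination -gradSq f x * secCoef_sq_add N a x
  have hs : (∫ x, f x ^ 2) = (∫ x, (secCoef N a 0 x * f x) ^ 2) +
      ∫ x, (secCoef N a (π / 2) x * f x) ^ 2 := by
    rw [← integral_add (hv _).integrable_sq (hv _).integrable_sq]
    congr 1; ext x
    linear_combination -f x ^ 2 * secCoef_sq_add N a x
  rw [dform_self (hv _), dform_self (hv _), dform_self hf, hg, hs]
  ring

lemma dform_secCoef_le {f : ℝ × ℝ → ℝ} (hN : 0 < N) (h : IsProfile ω N a f)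
    (hlam : lam ≤ symLambda1 ω N 1) :
    dform lam (fun y => secCoef N a 0 y * f y) (fun y => secCoef N a 0 y * f y) ≤
      dform lam f f := by
  have := dform_self_nonneg hlam (testFun_secCoef_mul hN h.test h.lines (π / 2))
    (inAClass_secCoef_mul hN h.rot h.lines (π / 2))
  linarith [dform_secCoef_add (lam := lam) hN h]

lemma tendsto_integral_radLap (hN : 3 ≤ N) (hω : ∀ x ∈ ω, ∀ j : ℕ, rot (2 * π / N * j) x ∈ ω)
    (hlam : lam ≤ symLambda1 ω N 1) {f : ℕ → ℝ × ℝ → ℝ} (h : ∀ n, IsProfile ω N a (f n))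
    (hq : ∀ n, dform lam (f n) (f n) ≤ 1 / ((n : ℝ) + 1)) {p : ℝ × ℝ} {R β : ℝ} (hR : 0 < R)
    (hβ : 0 < β) (hp : {x | nsq (x - p) ≤ R ^ 2} ⊆ ω) :
    Tendsto (fun n => ∫ x, secCoef N a 0 x * f n x * radLap lam β R (nsq (x - p))) atTop (𝓝 0) := by
  have hN0 : 0 < N := by omega
  have hN' : (0 : ℝ) < N := by exact_mod_cast hN0
  set w := symBump N β R p
  have hw : testFun ω w := testFun_symBump hβ hR hω hp
  have hwc : inAClass N 1 w := inAClass_symBump hN0 β R p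
  set q := dform lam w w
  have hq0 : 0 ≤ q := dform_self_nonneg hlam hw hwc
  have hsq : ∀ n, (∫ x, secCoef N a 0 x * f n x * radLap lam β R (nsq (x - p))) ^ 2 ≤
      4 / N ^ 2 * q * (1 / ((n : ℝ) + 1)) := fun n => by
    have hv := testFun_secCoef_mul hN0 (h n).test (h n).lines 0
    have hvc := inAClass_secCoef_mul hN0 (h n).rot (h n).lines 0
    have hb := dform_sq_le hv.isTest hw.isTest fun t =>
      dform_self_nonneg hlam (hv.add_const_mul hw t) (hvc.add_const_mul hwc t)
    rw [dform_symBump hN (h n).test.isTest (h n).rot (h n).lines hβ hR p] at hb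
    have hb2 := mul_le_mul_of_nonneg_right ((dform_secCoef_le hN0 (h n) hlam).trans (hq n)) hq0
    set I := ∫ x, secCoef N a 0 x * f n x * radLap lam β R (nsq (x - p))
    have : I ^ 2 = 4 / N ^ 2 * (-(N / 2 * I)) ^ 2 := by field_simp; ring
    rw [this, mul_assoc]
    gcongr
    linarith
  have hlim : Tendsto (fun n : ℕ => √(4 / N ^ 2 * q * (1 / ((n : ℝ) + 1)))) atTop (𝓝 0) := by
    simpa using (tendsto_one_div_add_atTop_nhds_zero_nat.const_mul (4 / (N : ℝ) ^ 2 * q)).sqrt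
  exact squeeze_zero_norm (fun n => Real.abs_le_sqrt (hsq n)) hlim

lemma integral_secCoef_mul_pow_four_le {f : ℝ × ℝ → ℝ} (hf : IsTest f) (hN : 0 < N)
    (hf0 : ∀ x, OnLines N a x → f =ᶠ[nhds x] 0) :
    ∫ x, (secCoef N a 0 x * f x) ^ 4 ≤ ∫ x, f x ^ 4 := by
  have hint : ∀ {g : ℝ × ℝ → ℝ}, IsTest g → Integrable fun x => g x ^ 4 := fun hg =>
    (hg.continuous.pow 4).integrable_of_hasCompactSupport (hg.2.fun_pow (by norm_num))
  refine integral_mono (hint (isTest_secCoef_mul hN hf hf0 0)) (hint hf) fun x => ?_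
  have h1 : secCoef N a 0 x ^ 4 ≤ 1 := by
    rw [← Even.pow_abs (by decide : Even 4)]
    exact pow_le_one₀ (abs_nonneg _) (abs_secCoef_le N a 0 x)
  simp only [mul_pow]
  exact mul_le_of_le_one_left (by positivity) h1

end Limits

section Sectors

open Filter Topology

variable {R₁ R₂ : ℝ} {N : ℕ} {ε a lam : ℝ}

lemma volume_crackedDomain_ne_top (hR₁ : 0 < R₁) (hR₁₂ : R₁ < R₂) (hN : 0 < N) :
    volume (crackedDomain R₁ R₂ N ε) ≠ ⊤ := by
  refine ((measure_mono fun x hx => ?_).trans_lt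
    (measure_closedBall_lt_top (x := (0 : ℝ × ℝ)) (r := R₂))).ne
  refine nsq_sub_le_subset_closedBall 0 (by linarith) ?_
  rw [mem_ofPred_eq, sub_zero]
  exact ((mem_crackedDomain hR₁ hR₁₂ hN).1 hx).1.le

lemma exists_bound_integral_pow_four {ω : Set (ℝ × ℝ)} {f : ℕ → ℝ × ℝ → ℝ}
    (h : ∀ n, IsProfile ω N a (f n)) (hq : ∀ n, dform lam (f n) (f n) ≤ 1 / ((n : ℝ) + 1)) :
    ∃ C, ∀ n, ∫ x, f n x ^ 4 ≤ C := by
  obtain ⟨C, hC0, hC⟩ := exists_integral_pow_four_le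
  refine ⟨C * (2 + (lam + 1)) ^ 2, fun n => (hC _ (h n).test.isTest).trans ?_⟩
  have h1 := hq n
  rw [dform_self (h n).test.isTest, (h n).norm] at h1
  have h2 : 1 / ((n : ℝ) + 1) ≤ 1 := by
    rw [div_le_one (by positivity)]; linarith [(n.cast_nonneg : (0 : ℝ) ≤ n)]
  have h3 := integral_gradSq_nonneg (f n)
  rw [(h n).norm]
  gcongr <;> linarith

lemma tendsto_setIntegral_halfPlane (hR₁ : 0 < R₁) (hR₁₂ : R₁ < R₂) (hN : 4 ≤ N) (hε : 0 < ε)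
    (k : ℤ) (h1 : a ≤ 2 * π * k / N) (h2 : 2 * π * k / N + ε ≤ a + π) (hlam0 : 0 ≤ lam)
    (hlam : lam ≤ symLambda1 (crackedDomain R₁ R₂ N ε) N 1) {f : ℕ → ℝ × ℝ → ℝ}
    (h : ∀ n, IsProfile (crackedDomain R₁ R₂ N ε) N a (f n))
    (hq : ∀ n, dform lam (f n) (f n) ≤ 1 / ((n : ℝ) + 1)) :
    Tendsto (fun n => ∫ x in halfPlane a ∩ crackedDomain R₁ R₂ N ε, (secCoef N a 0 x * f n x) ^ 2)
      atTop (𝓝 0) := by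
  have hN0 : 0 < N := by omega
  have hN' : (4 : ℝ) ≤ N := by exact_mod_cast hN
  have hpi := Real.pi_pos
  set Ω := crackedDomain R₁ R₂ N ε with hΩ
  have hΩo : IsOpen Ω := isOpen_crackedDomain hR₁ hR₁₂ hN0
  set W := halfPlane a ∩ Ω with hW
  have hWo : IsOpen W := (isOpen_halfPlane a).inter hΩo
  have hF : ∀ n, IsTest (fun x => secCoef N a 0 x * f n x) := fun n =>
    isTest_secCoef_mul hN0 (h n).test.isTest (h n).lines 0
  have hpos : ∀ n, ∀ x ∈ W, 0 ≤ secCoef N a 0 x * f n x := fun n x hx =>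
    mul_nonneg (secCoef_nonneg hN0 hx.1) ((h n).nonneg x)
  have hrot : ∀ x ∈ Ω, ∀ j : ℕ, rot (2 * π / N * j) x ∈ Ω := fun x hx j => by
    have := rot_mem_crackedDomain hR₁ hR₁₂ hN0 hx j
    rwa [show 2 * π * ((j : ℤ) : ℝ) / N = 2 * π / N * j by push_cast; ring] at this
  obtain ⟨C, hC⟩ := exists_bound_integral_pow_four h hq
  have hw1 : 2 * π / N ≤ π / 2 := by
    rw [div_le_div_iff₀ (by positivity) (by norm_num)]; nlinarith
  have hw0 : 0 < 2 * π / N := by positivity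
  set V₀ := halfPlane a ∩ halfPlane (a + 2 * π / N - π) ∩ {x | nsq x < R₁ ^ 2} with hV₀
  refine tendsto_setIntegral_sq hF hpos hWo
    (ne_top_of_le_ne_top (volume_crackedDomain_ne_top (ε := ε) hR₁ hR₁₂ hN0)
      (measure_mono inter_subset_right))
    (fun n => (integral_secCoef_mul_pow_four_le (h n).test.isTest hN0 (h n).lines).trans (hC n))
    fun x hx => exists_nhds_tendsto_setIntegral (V₀ := V₀) hlam0 hF hpos hWo
      (isPreconnected_halfPlane_inter hR₁ hR₁₂ hN0 hε k h1 h2)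
      (fun p R β hR hβ hp => tendsto_integral_radLap (by omega) hrot hlam h hq hR hβ
        (hp.trans inter_subset_right)) ?_ ?_ ?_ ?_ hx
  · exact ((isOpen_halfPlane _).inter (isOpen_halfPlane _)).inter
      (isOpen_lt continuous_nsq continuous_const)
  · refine ⟨polarPt (R₁ / 2) (a + π / N), ⟨polarPt_mem_halfPlane (by positivity) ⟨?_, ?_⟩,
      polarPt_mem_halfPlane (by positivity) ⟨?_, ?_⟩⟩, ?_⟩
    · have : 0 < π / N := by positivity
      linarith
    · have : 2 * π / N = 2 * (π / N) := by ring
      linarith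
    · have : 2 * π / N = 2 * (π / N) := by ring
      linarith
    · have : 2 * π / N = 2 * (π / N) := by ring
      linarith
    · rw [mem_ofPred_eq, nsq_polarPt]; nlinarith
  · rintro y ⟨⟨hy1, -⟩, hy2⟩
    have hy2' : nsq y < R₁ ^ 2 := hy2
    exact ⟨hy1, (mem_crackedDomain hR₁ hR₁₂ hN0).2 ⟨by nlinarith, Or.inl hy2'.ne⟩⟩
  · refine tendsto_const_nhds.congr fun n => (setIntegral_eq_zero_of_forall_eq_zero ?_).symm
    rintro y ⟨⟨hy1, hy3⟩, -⟩
    obtain ⟨r, θ, hr, hθ, rfl⟩ := exists_polarPt_of_mem_halfPlane hy1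
    have hθ2 : θ < a + 2 * π / N := by
      by_contra! hge
      have hy3' : 0 < Real.cos (a + 2 * π / N - π) * (r * Real.sin θ) -
        Real.sin (a + 2 * π / N - π) * (r * Real.cos θ) := hy3
      have he : Real.cos (a + 2 * π / N - π) * (r * Real.sin θ) -
          Real.sin (a + 2 * π / N - π) * (r * Real.cos θ) =
          -(r * Real.sin (θ - (a + 2 * π / N))) := by
        rw [Real.cos_sub_pi, Real.sin_sub_pi, Real.sin_sub]; ring
      have hs : 0 ≤ Real.sin (θ - (a + 2 * π / N)) :=
        Real.sin_nonneg_of_nonneg_of_le_pi (by linarith) (by linarith [hθ.2])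
      nlinarith [mul_nonneg hr.le hs]
    rw [secCoef_polarPt_eq hN0 a hr 0 ⟨by simpa using hθ.1.le, by simpa using hθ2⟩]
    simp

lemma sin_sq_mul_le_sum {f : ℝ × ℝ → ℝ} (hN : 4 ≤ N)
    (h : IsProfile (crackedDomain R₁ R₂ N ε) N a f) (x : ℝ × ℝ) :
    Real.sin (2 * π / N) ^ 2 * f x ^ 2 ≤ ∑ k ∈ Finset.range N,
      (halfPlane (a + 2 * π * (k : ℤ) / N) ∩ crackedDomain R₁ R₂ N ε).indicator
        (fun y => (secCoef N (a + 2 * π * (k : ℤ) / N) 0 y * f y) ^ 2) x := by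
  have hN0 : 0 < N := by omega
  have hN' : (4 : ℝ) ≤ N := by exact_mod_cast hN
  have hpi := Real.pi_pos
  have hterm : ∀ k ∈ Finset.range N, 0 ≤
      (halfPlane (a + 2 * π * (k : ℤ) / N) ∩ crackedDomain R₁ R₂ N ε).indicator
        (fun y => (secCoef N (a + 2 * π * (k : ℤ) / N) 0 y * f y) ^ 2) x := fun k _ =>
    indicator_nonneg (fun y _ => sq_nonneg _) x
  by_cases hfx : f x = 0
  · rw [hfx]; simpa using Finset.sum_nonneg hterm
  have hxΩ : x ∈ crackedDomain R₁ R₂ N ε := h.test.2.2 (subset_tsupport f hfx)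
  have hx0 : x ≠ 0 := by
    rintro rfl; exact hfx (h.lines 0 (onLines_zero N a)).eq_of_nhds
  have hw1 : 2 * π / N ≤ π / 2 := by
    rw [div_le_div_iff₀ (by positivity) (by norm_num)]; nlinarith
  have hw0 : 0 < 2 * π / N := by positivity
  obtain ⟨r, θ, hr, hθ, rfl⟩ := exists_polarPt_mem_Ico hx0 (a + 2 * π / N)
  set s := (θ - (a + 2 * π / N)) * N / (2 * π) with hs
  have hs0 : 0 ≤ s := by have : 0 ≤ θ - (a + 2 * π / N) := by linarith [hθ.1]
                         positivity
  have hsN : s < N := by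
    rw [hs, div_lt_iff₀ (by positivity), mul_comm (N : ℝ)]
    gcongr; linarith [hθ.2]
  have hθs : θ = a + 2 * π / N + 2 * π / N * s := by rw [hs]; field_simp; ring
  set k := ⌊s⌋₊ with hk
  have hk1 : (k : ℝ) ≤ s := Nat.floor_le hs0
  have hk2 : s < k + 1 := Nat.lt_floor_add_one s
  have hkN : k ∈ Finset.range N := Finset.mem_range.2 ((Nat.floor_lt hs0).2 hsN)
  have hak : a + 2 * π * ((k : ℤ) : ℝ) / N = a + 2 * π / N * k := by push_cast; ring
  have m1 : 2 * π / N * k ≤ 2 * π / N * s := by gcongr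
  have m2 : 2 * π / N * s < 2 * π / N * (k + 1) := by gcongr
  refine le_trans (le_of_eq ?_) (Finset.single_le_sum hterm hkN)
  rw [indicator_of_mem, hak, secCoef_polarPt_eq hN0 _ hr 1 ⟨?_, ?_⟩]
  · push_cast; ring_nf
  · push_cast; linarith
  · push_cast; linarith
  · rw [hak]
    exact ⟨polarPt_mem_halfPlane hr ⟨by linarith, by linarith⟩, hxΩ⟩

lemma not_symLambda1_half_le (hR₁ : 0 < R₁) (hR₁₂ : R₁ < R₂) (hN : 4 ≤ N) (hNe : Even N)
    (hε : ε ∈ Ioo (0 : ℝ) (π / N)) :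
    ¬ symLambda1 (crackedDomain R₁ R₂ N ε) N (N / 2) ≤
      symLambda1 (crackedDomain R₁ R₂ N ε) N 1 := by
  intro hlam
  have hN0 : 0 < N := by omega
  have hN' : (4 : ℝ) ≤ N := by exact_mod_cast hN
  have hpi := Real.pi_pos
  have hw1 : 2 * π / N ≤ π / 2 := by
    rw [div_le_div_iff₀ (by positivity) (by norm_num)]; nlinarith
  have hw0 : 0 < 2 * π / N := by positivity
  have hw2 : 2 * π / N = 2 * (π / N) := by ring
  set Ω := crackedDomain R₁ R₂ N ε with hΩ
  have hne := exists_inAClass_half (ω := Ω) hN0 hNe (R := R₁ / 2) (by positivity) fun x hx =>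
    (mem_crackedDomain hR₁ hR₁₂ hN0).2 ⟨by nlinarith, Or.inl (by nlinarith : nsq x < R₁ ^ 2).ne⟩
  obtain ⟨a, ha, f, hf⟩ := exists_seq_isProfile hN0 hNe
    (fun x hx => refl₁_mem_crackedDomain hR₁ hR₁₂ hN0 hx) hne
  have ha' : -(π / N) ≤ a ∧ a ≤ 0 := by
    rcases ha with rfl | rfl
    · exact ⟨by linarith, le_rfl⟩
    · rw [neg_div]; exact ⟨le_rfl, by linarith⟩
  set b : ℕ → ℝ := fun k => a + 2 * π * (k : ℤ) / N with hb
  have hlim : Tendsto (fun n => ∑ k ∈ Finset.range N,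
      ∫ x in halfPlane (b k) ∩ Ω, (secCoef N (b k) 0 x * f n x) ^ 2) atTop (𝓝 0) := by
    have := tendsto_finsetSum (Finset.range N) fun k _ =>
      tendsto_setIntegral_halfPlane (a := b k) hR₁ hR₁₂ hN hε.1 k (by simp only [hb]; linarith)
        (by simp only [hb]; linarith [hε.2]) (symLambda1_nonneg _ _ _) hlam
        (fun n => (hf n).1.shift k) fun n => (hf n).2
    rwa [Finset.sum_const_zero] at this
  have hδ : 0 < Real.sin (2 * π / N) ^ 2 :=
    pow_pos (Real.sin_pos_of_pos_of_lt_pi hw0 (by linarith)) 2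
  refine absurd (ge_of_tendsto' hlim fun n => ?_) (not_le.2 hδ)
  have hWm : ∀ k, MeasurableSet (halfPlane (b k) ∩ Ω) := fun k =>
    ((isOpen_halfPlane _).inter (isOpen_crackedDomain hR₁ hR₁₂ hN0)).measurableSet
  have hi : ∀ k, Integrable fun x => (secCoef N (b k) 0 x * f n x) ^ 2 := fun k =>
    (isTest_secCoef_mul hN0 (hf n).1.test.isTest ((hf n).1.shift k).lines 0).integrable_sq
  calc Real.sin (2 * π / N) ^ 2 = ∫ x, Real.sin (2 * π / N) ^ 2 * f n x ^ 2 := by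
        rw [integral_const_mul, (hf n).1.norm, mul_one]
    _ ≤ ∫ x, ∑ k ∈ Finset.range N, (halfPlane (b k) ∩ Ω).indicator
        (fun y => (secCoef N (b k) 0 y * f n y) ^ 2) x :=
      integral_mono ((hf n).1.test.isTest.integrable_sq.const_mul _)
        (integrable_finsetSum _ fun k _ => (hi k).indicator (hWm k))
        (sin_sq_mul_le_sum hN (hf n).1)
    _ = _ := by
      rw [integral_finsetSum _ fun k _ => (hi k).indicator (hWm k)]
      exact Finset.sum_congr rfl fun k _ => integral_indicator (hWm k)

end Sectors

/-- for even `N ≥ 4` and any `ε ∈ (0, π/N)`, the lowest Dirichlet eigenvalue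
of `𝔇(N,ε)` in the class `A_{N/2}` is strictly larger than the one in the class `A_1`. -/
theorem symLambda1_half_gt_symLambda1_one
    (R₁ R₂ : ℝ) (hR₁ : 0 < R₁) (hR₁₂ : R₁ < R₂)
    (N : ℕ) (hN : 4 ≤ N) (hNeven : Even N)
    (ε : ℝ) (hε : ε ∈ Set.Ioo (0 : ℝ) (π / N)) :
    symLambda1 (crackedDomain R₁ R₂ N ε) N 1 <
      symLambda1 (crackedDomain R₁ R₂ N ε) N (N / 2) := by
  exact not_le.1 (not_symLambda1_half_le hR₁ hR₁₂ hN hNeven hε)
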